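/- arXiv:2601.05863 — 4 statements merged into one kernel-verified Lean document; each statement's English description precedes it below -/
import Mathlib

section
/- Let D₁, D₂, D₃ ⊂ S² be pairwise disjoint topological closed discs and let ψ : S¹ → S² be a Jordan curve. If there exist two disjoint intervals [a₁,b₁], [a₂,b₂] ⊂ S¹ such that ψ(aᵢ) lies in the interior of D₁, ψ(bᵢ) lies in the interior of D₂, and ψ([aᵢ,bᵢ]) ∩ D₃ = ∅ for i = 1,2, then there exists an interval [c,d] ⊂ S¹ such that ψ(c) lies in the interior of D₂, ψ(d) lies in the interior of D₁, and ψ([c,d]) ∩ D₃ = ∅. -/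
open scoped NNReal
open Filter Topology

/-- `S²`, the unit sphere of `ℝ³`. -/
noncomputable abbrev Sphere2 : Set (EuclideanSpace ℝ (Fin 3)) :=
  Metric.sphere (0 : EuclideanSpace ℝ (Fin 3)) 1

/-- A topological closed disc in `S²`: a subset homeomorphic to the closed unit disc of `ℝ²`. -/
def IsTopologicalClosedDisc (D : Set Sphere2) : Prop :=
  Nonempty (D ≃ₜ (Metric.closedBall (0 : EuclideanSpace ℝ (Fin 2)) 1))

/-- The positively oriented closed arc of `S¹ = ℝ/ℤ` from `a` to `a + ℓ`. -/
def circleArc (a : AddCircle (1 : ℝ)) (ℓ : ℝ) : Set (AddCircle (1 : ℝ)) :=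
  (fun s : ℝ => a + (s : AddCircle (1 : ℝ))) '' Set.Icc 0 ℓ

theorem exists_continuousMap_log {X : Type*} [TopologicalSpace X] [ContractibleSpace X]
    (f : C(X, ℂ)) (hf : ∀ x, f x ≠ 0) : ∃ g : C(X, ℂ), ∀ x, Complex.exp (g x) = f x := by
  obtain ⟨x₀, ⟨H⟩⟩ := id_nullhomotopic X
  let F : C(X, {z : ℂ // z ≠ 0}) := ⟨fun x ↦ ⟨f x, hf x⟩, by fun_prop⟩
  let H' : C(unitInterval × X, {z : ℂ // z ≠ 0}) := F.comp H.symm.toContinuousMap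
  have h0 : ∀ x, H' (0, x) = (fun z : ℂ ↦ (⟨_, z.exp_ne_zero⟩ : {z : ℂ // z ≠ 0}))
      (ContinuousMap.const X (Complex.log (f x₀)) x) := by
    intro x
    ext
    simp [H', F, Complex.exp_log (hf x₀)]
  refine ⟨(Complex.isCoveringMap_exp.liftHomotopy H' _ h0).comp ⟨fun x ↦ (1, x), by fun_prop⟩,
    fun x ↦ ?_⟩
  have h := congrArg Subtype.val
    (congrFun (Complex.isCoveringMap_exp.liftHomotopy_lifts H' _ h0) (1, x))
  have h1 : (H' (1, x) : ℂ) = f x := by simp [H', F]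
  exact h.trans h1

theorem exists_continuousOn_log {E : Type*} [TopologicalSpace E] (X : Set E) [ContractibleSpace X]
    {f : E → ℂ} (hf : ContinuousOn f X) (h0 : ∀ x ∈ X, f x ≠ 0) :
    ∃ g : E → ℂ, ContinuousOn g X ∧ ∀ x ∈ X, Complex.exp (g x) = f x := by
  classical
  obtain ⟨g, hg⟩ := exists_continuousMap_log ⟨fun x : X ↦ f x, hf.domRestrict⟩ fun x ↦ h0 x x.2
  refine ⟨fun x ↦ if hx : x ∈ X then g ⟨x, hx⟩ else 0, ?_, fun x hx ↦ ?_⟩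
  · rw [continuousOn_iff_continuous_domRestrict]
    convert g.continuous using 1
    ext x
    simp
  · simp only [dif_pos hx]
    exact hg ⟨x, hx⟩

theorem Convex.exists_continuousOn_log {E : Type*} [AddCommGroup E] [Module ℝ E]
    [TopologicalSpace E] [IsTopologicalAddGroup E] [ContinuousSMul ℝ E] {X : Set E}
    (hX : Convex ℝ X) (hne : X.Nonempty)
    {f : E → ℂ} (hf : ContinuousOn f X) (h0 : ∀ x ∈ X, f x ≠ 0) :
    ∃ g : E → ℂ, ContinuousOn g X ∧ ∀ x ∈ X, Complex.exp (g x) = f x :=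
  have := hX.contractibleSpace hne
  _root_.exists_continuousOn_log X hf h0

/-- A continuous function whose exponential is constant on a preconnected set is constant there. -/
theorem IsPreconnected.eq_of_exp_eq {E : Type*} [TopologicalSpace E] {X : Set E}
    (hX : IsPreconnected X) {g : E → ℂ} (hg : ContinuousOn g X) {c : ℂ}
    (h : ∀ x ∈ X, Complex.exp (g x) = c) {x y : E} (hx : x ∈ X) (hy : y ∈ X) : g x = g y := by
  refine Complex.isCoveringMap_exp.eqOn_of_comp_eqOn hX hg
    (continuousOn_const (c := g y)) (fun z hz ↦ ?_) hy rfl hx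
  ext
  simp [h z hz, h y hy]

/-- `(w - u) / (w - v)` has a continuous logarithm on `X`. -/
def LogEquiv (X : Set ℂ) (u v : ℂ) : Prop :=
  ∃ g : ℂ → ℂ, ContinuousOn g X ∧ ∀ w ∈ X, Complex.exp (g w) * (w - v) = w - u

theorem LogEquiv.symm {X : Set ℂ} {u v : ℂ} (h : LogEquiv X u v) : LogEquiv X v u := by
  obtain ⟨g, hg, h⟩ := h
  refine ⟨fun w ↦ -g w, hg.neg, fun w hw ↦ ?_⟩
  rw [← h w hw, ← mul_assoc, ← Complex.exp_add]
  simp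

theorem LogEquiv.trans {X : Set ℂ} {u v t : ℂ} (h : LogEquiv X u v) (h' : LogEquiv X v t) :
    LogEquiv X u t := by
  obtain ⟨g, hg, h⟩ := h
  obtain ⟨g', hg', h'⟩ := h'
  refine ⟨fun w ↦ g w + g' w, hg.add hg', fun w hw ↦ ?_⟩
  rw [← h w hw, ← h' w hw, Complex.exp_add, mul_assoc]

theorem eventually_logEquiv {X : Set ℂ} (hX : IsClosed X) {u : ℂ} (hu : u ∉ X) :
    ∀ᶠ v in 𝓝 u, LogEquiv X u v := by
  obtain ⟨δ, hδ, hball⟩ := Metric.isOpen_iff.1 hX.isOpen_compl u hu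
  filter_upwards [Metric.ball_mem_nhds u hδ] with v hv
  refine LogEquiv.symm ⟨fun w ↦ Complex.log (1 + (u - v) / (w - u)), ?_, fun w hw ↦ ?_⟩
  all_goals
    have key : ∀ w ∈ X, w - u ≠ 0 ∧ 1 + (u - v) / (w - u) ∈ Complex.slitPlane := by
      intro w hw
      have h1 : δ ≤ ‖w - u‖ := by
        by_contra! h
        exact hball (by simpa [dist_eq_norm] using h) hw
      refine ⟨norm_pos_iff.1 (hδ.trans_le h1), Complex.mem_slitPlane_of_norm_lt_one ?_⟩
      rw [norm_div, div_lt_one (hδ.trans_le h1)]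
      rw [Metric.mem_ball, dist_comm, dist_eq_norm] at hv
      exact hv.trans_le h1
  · refine ContinuousOn.clog ?_ fun w hw ↦ (key w hw).2
    exact continuousOn_const.add (continuousOn_const.div (by fun_prop) fun w hw ↦ (key w hw).1)
  · rw [Complex.exp_log (Complex.slitPlane_ne_zero (key w hw).2)]
    field_simp [(key w hw).1]
    ring

theorem IsPreconnected.logEquiv {X S : Set ℂ} (hS : IsPreconnected S) (hX : IsClosed X)
    (hSX : Disjoint S X) {u v : ℂ} (hu : u ∈ S) (hv : v ∈ S) : LogEquiv X u v := by
  refine hS.induction₂' (LogEquiv X) (fun x hx ↦ ?_) (fun _ _ _ _ _ _ ↦ LogEquiv.trans) hu hv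
  filter_upwards [nhdsWithin_le_nhds (eventually_logEquiv hX (hSX.notMem_of_mem_left hx))] with y hy
  exact ⟨hy, hy.symm⟩

/-- The argument of Borsuk: an injective continuous map of a plane disc covers a neighbourhood of the
image of the centre. -/
theorem image_closedBall_mem_nhds {f : ℂ → ℂ} {z₀ : ℂ} {r : ℝ} (hr : 0 < r)
    (hf : ContinuousOn f (Metric.closedBall z₀ r)) (hinj : Set.InjOn f (Metric.closedBall z₀ r)) :
    f '' Metric.closedBall z₀ r ∈ 𝓝 (f z₀) := by
  have hz₀ : z₀ ∈ Metric.closedBall z₀ r := Metric.mem_closedBall_self hr.le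
  have hX : IsClosed (f '' Metric.sphere z₀ r) :=
    ((isCompact_sphere z₀ r).image_of_continuousOn
      (hf.mono Metric.sphere_subset_closedBall)).isClosed
  have hzX : f z₀ ∉ f '' Metric.sphere z₀ r := by
    rintro ⟨z, hz, hzz⟩
    rw [hinj (Metric.sphere_subset_closedBall hz) hz₀ hzz] at hz
    simp [hr.ne] at hz
  filter_upwards [eventually_logEquiv hX hzX] with w hw
  by_contra hwf
  obtain ⟨g, hg, hgw⟩ := hw
  obtain ⟨l, hl, hlw⟩ := (convex_closedBall z₀ r).exists_continuousOn_log ⟨z₀, hz₀⟩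
    (hf.sub continuousOn_const (g := fun _ ↦ w))
    (fun z hz ↦ sub_ne_zero.2 fun h ↦ hwf ⟨z, hz, h⟩)
  let c : ℝ → ℂ := fun θ ↦ r * Complex.exp (θ * Complex.I)
  have hcc : Continuous c := by fun_prop
  have hcn : ∀ θ, ‖c θ‖ = r := fun θ ↦ by simp [c, Complex.norm_exp_ofReal_mul_I, abs_of_pos hr]
  have hcπ : ∀ θ, c (θ + Real.pi) = -c θ := fun θ ↦ by
    simp [c, add_mul, Complex.exp_add, Complex.exp_pi_mul_I]
  have hc2 : ∀ θ, c (θ + Real.pi + Real.pi) = c θ := fun θ ↦ by simp [hcπ]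
  have hcS : ∀ θ, z₀ + c θ ∈ Metric.sphere z₀ r := fun θ ↦ by simp [hcn]
  let Q : Set (ℝ × ℝ) := Set.Icc 0 1 ×ˢ Set.univ
  have hQ : Convex ℝ Q := (convex_Icc 0 1).prod convex_univ
  have hin : ∀ p ∈ Q, z₀ + c p.2 / (1 + p.1 : ℝ) ∈ Metric.closedBall z₀ r ∧
      z₀ - p.1 * c p.2 / (1 + p.1 : ℝ) ∈ Metric.closedBall z₀ r := by
    rintro ⟨t, θ⟩ ⟨⟨h0, h1⟩, -⟩
    simp only at h0 h1 ⊢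
    have h2 : 0 < 1 + t := by linarith
    constructor
    · rw [Metric.mem_closedBall, dist_eq_norm, add_sub_cancel_left, norm_div, hcn,
        Complex.norm_real, Real.norm_of_nonneg h2.le, div_le_iff₀ h2]
      nlinarith
    · rw [Metric.mem_closedBall, dist_eq_norm, sub_sub_cancel_left, norm_neg, norm_div, norm_mul,
        hcn, Complex.norm_real, Complex.norm_real, Real.norm_of_nonneg h2.le,
        Real.norm_of_nonneg h0, div_le_iff₀ h2]
      nlinarith
  have hden : ∀ p ∈ Q, ((1 + p.1 : ℝ) : ℂ) ≠ 0 := by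
    rintro ⟨t, θ⟩ ⟨⟨h0, h1⟩, -⟩
    simp only at h0
    exact_mod_cast (by linarith : 1 + t ≠ 0)
  obtain ⟨M, hM, hMe⟩ := hQ.exists_continuousOn_log (f := fun p ↦
      f (z₀ + c p.2 / (1 + p.1 : ℝ)) - f (z₀ - p.1 * c p.2 / (1 + p.1 : ℝ))) ⟨(0, 0), by simp [Q]⟩
    (by
      refine ContinuousOn.sub (hf.comp ?_ fun p hp ↦ (hin p hp).1)
        (hf.comp ?_ fun p hp ↦ (hin p hp).2)
      · exact continuousOn_const.add (ContinuousOn.div (by fun_prop) (by fun_prop) hden)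
      · exact continuousOn_const.sub (ContinuousOn.div (by fun_prop) (by fun_prop) hden))
    (by
      intro p hp h
      have h1 := hinj (hin p hp).1 (hin p hp).2 (sub_eq_zero.1 h)
      have h2 := hden p hp
      have h3 : c p.2 * ((1 + p.1 : ℝ) : ℂ) = 0 := by
        rw [sub_eq_add_neg, add_right_inj, ← neg_div, div_left_inj' h2] at h1
        push_cast
        linear_combination h1
      have h4 : c p.2 ≠ 0 := norm_pos_iff.1 (by rw [hcn]; exact hr)
      exact (mul_ne_zero h4 h2) h3)
  have hshift : ContinuousOn (fun p : ℝ × ℝ ↦ M (p.1, p.2 + Real.pi + Real.pi) - M p) Q := by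
    refine ContinuousOn.sub (hM.comp (by fun_prop) ?_) hM
    rintro ⟨t, θ⟩ ⟨h, -⟩
    exact ⟨h, trivial⟩
  have hd := hQ.isPreconnected.eq_of_exp_eq hshift (c := 1) (by
    rintro ⟨t, θ⟩ hp
    have hp' : (t, θ + Real.pi + Real.pi) ∈ Q := ⟨hp.1, trivial⟩
    rw [Complex.exp_sub, hMe _ hp, hMe _ hp']
    simp only [hc2]
    rw [← hMe _ hp, div_self (Complex.exp_ne_zero _)])
    (x := (0, 0)) (y := (1, 0)) (by simp [Q]) (by simp [Q])
  have h0 : M (0, 0 + Real.pi + Real.pi) - M (0, 0) = 0 := by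
    have h := isPreconnected_univ.eq_of_exp_eq (E := ℝ)
      (g := fun θ ↦ M (0, θ) - (g (f (z₀ + c θ)) + l (z₀ + c θ))) (c := 1) (by
      refine ContinuousOn.sub (hM.comp (by fun_prop) fun θ _ ↦ by simp [Q])
        (ContinuousOn.add (hg.comp (hf.comp (by fun_prop) ?_) ?_) (hl.comp (by fun_prop) ?_))
      · exact fun θ _ ↦ Metric.sphere_subset_closedBall (hcS θ)
      · exact fun θ _ ↦ ⟨_, hcS θ, rfl⟩
      · exact fun θ _ ↦ Metric.sphere_subset_closedBall (hcS θ))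
      (fun θ _ ↦ by
        have hl' : Complex.exp (l (z₀ + c θ)) = f (z₀ + c θ) - w :=
          hlw _ (Metric.sphere_subset_closedBall (hcS θ))
        rw [Complex.exp_sub, Complex.exp_add, hMe _ (by simp [Q]), hl', hgw _ ⟨_, hcS θ, rfl⟩]
        have : f (z₀ + c θ) - f z₀ ≠ 0 := sub_ne_zero.2 fun h ↦ hzX ⟨_, hcS θ, h⟩
        simp [div_self this])
      (x := 0 + Real.pi + Real.pi) (y := 0) trivial trivial
    simp only [hc2] at h
    linear_combination h
  have h1 : ∀ θ, M (1, θ + Real.pi) - M (1, θ) = M (1, 0 + Real.pi) - M (1, 0) ∧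
      Complex.exp (M (1, θ + Real.pi) - M (1, θ)) = -1 := by
    have he : ∀ θ, Complex.exp (M (1, θ + Real.pi) - M (1, θ)) = -1 := by
      intro θ
      have hne := Complex.exp_ne_zero (M (1, θ))
      rw [hMe _ (by simp [Q])] at hne
      rw [Complex.exp_sub, hMe _ (by simp [Q]), hMe _ (by simp [Q]), div_eq_iff hne]
      simp only [hcπ, Complex.ofReal_one, one_mul]
      rw [neg_div, sub_neg_eq_add, ← sub_eq_add_neg]
      ring
    refine fun θ ↦ ⟨?_, he θ⟩
    exact isPreconnected_univ.eq_of_exp_eq (E := ℝ)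
      (g := fun θ ↦ M (1, θ + Real.pi) - M (1, θ)) (c := -1)
      (ContinuousOn.sub (hM.comp (by fun_prop) fun θ _ ↦ by simp [Q])
        (hM.comp (by fun_prop) fun θ _ ↦ by simp [Q])) (fun θ _ ↦ he θ) trivial trivial
  have h2 := (h1 (0 + Real.pi)).1
  have h3 := (h1 0).2
  rw [h0] at hd
  simp only at hd
  have h4 : M (1, 0 + Real.pi) - M (1, 0) = 0 := by linear_combination (-h2 - hd) / 2
  rw [h4, Complex.exp_zero] at h3
  norm_num at h3

/-- Invariance of domain in the plane. -/
theorem isOpen_image_of_injOn {f : ℂ → ℂ} {U : Set ℂ} (hU : IsOpen U) (hf : ContinuousOn f U)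
    (hinj : Set.InjOn f U) : IsOpen (f '' U) := by
  rw [isOpen_iff_mem_nhds]
  rintro _ ⟨z, hz, rfl⟩
  obtain ⟨r, hr, hrU⟩ := Metric.nhds_basis_closedBall.mem_iff.1 (hU.mem_nhds hz)
  exact mem_of_superset (image_closedBall_mem_nhds hr (hf.mono hrU) (hinj.mono hrU))
    (Set.image_mono hrU)

/-- The pairs of parameters `x < y < x + 1`. -/
def cyclicPairs : Set (ℝ × ℝ) := {p | p.1 < p.2 ∧ p.2 < p.1 + 1}

/-- A continuous square root of `ψ y - ψ x` changes sign after a full turn of a Jordan curve. -/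
theorem exists_sqrt_sub {ψ : ℝ → ℂ} (hψ : Continuous ψ) (hper : ∀ t, ψ (t + 1) = ψ t)
    (hinj : ∀ s t, s < t → t < s + 1 → ψ s ≠ ψ t) :
    ∃ σ : ℝ × ℝ → ℂ, ContinuousOn σ cyclicPairs ∧
      (∀ p ∈ cyclicPairs, σ p ^ 2 = ψ p.2 - ψ p.1) ∧
      ∀ p ∈ cyclicPairs, σ (p.1 + 1, p.2 + 1) = -σ p := by
  have hconv : Convex ℝ cyclicPairs := by
    rintro ⟨x, y⟩ ⟨h1, h2⟩ ⟨x', y'⟩ ⟨h3, h4⟩ a b ha hb hab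
    simp only at h1 h2 h3 h4
    simp only [cyclicPairs, Set.mem_ofPred_eq, Prod.fst_add, Prod.snd_add, Prod.smul_fst,
      Prod.smul_snd, smul_eq_mul]
    rcases ha.eq_or_lt with rfl | ha
    · simp only [zero_add] at hab
      subst hab
      constructor <;> linarith
    · constructor <;> nlinarith
  obtain ⟨M, hM, hMe⟩ := hconv.exists_continuousOn_log (f := fun p ↦ ψ p.2 - ψ p.1)
    ⟨(0, 1 / 2), by norm_num [cyclicPairs]⟩ (by fun_prop)
    (fun p hp ↦ sub_ne_zero.2 (hinj _ _ hp.1 hp.2).symm)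
  have hswap : ∀ p ∈ cyclicPairs, (p.2, p.1 + 1) ∈ cyclicPairs := by
    rintro ⟨x, y⟩ ⟨h1, h2⟩
    exact ⟨h2, by simpa using h1⟩
  have he : ∀ p ∈ cyclicPairs, Complex.exp (M (p.2, p.1 + 1) - M p) = -1 := by
    intro p hp
    have hne := Complex.exp_ne_zero (M p)
    rw [hMe _ hp] at hne
    rw [Complex.exp_sub, hMe _ hp, hMe _ (hswap p hp), div_eq_iff hne]
    simp [hper]
  have hc : ∀ p ∈ cyclicPairs, ∀ q ∈ cyclicPairs,
      M (p.2, p.1 + 1) - M p = M (q.2, q.1 + 1) - M q := fun p hp q hq ↦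
    hconv.isPreconnected.eq_of_exp_eq (g := fun p : ℝ × ℝ ↦ M (p.2, p.1 + 1) - M p)
      ((hM.comp (by fun_prop) hswap).sub hM) he hp hq
  refine ⟨fun p ↦ Complex.exp (M p / 2), by fun_prop, fun p hp ↦ ?_, fun p hp ↦ ?_⟩
  · rw [← hMe p hp, ← Complex.exp_nat_mul]
    congr 1
    push_cast
    ring
  · have h1 := hc _ (hswap p hp) p hp
    simp only at h1
    have h2 : M (p.1 + 1, p.2 + 1) / 2 = (M (p.2, p.1 + 1) - M p) + M p / 2 := by
      linear_combination h1 / 2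
    simp only [h2, Complex.exp_add, he p hp, neg_one_mul]

theorem ratio_eq_of_logEquiv {ψ : ℝ → ℂ} (hψ : Continuous ψ) {C : Set ℂ} (hC : IsPreconnected C)
    {r s : ℝ} (hrs : r ≤ s) (hr : ψ r ∈ C) (hs : ψ s ∈ C) {u v k : ℂ} (hk : k ≠ 0)
    (h : LogEquiv (C ∪ ψ '' Set.Icc r s) u v)
    (hv : v ∉ C ∪ ψ '' Set.Icc r s) {f : ℝ → ℂ} {κ : ℂ → ℂ} (hf : ContinuousOn f (Set.Icc r s))
    (hκ : ContinuousOn κ C) (hf2 : ∀ t ∈ Set.Icc r s, f t ^ 2 = k * (ψ t - u) * (ψ t - v))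
    (hκ2 : ∀ w ∈ C, κ w ^ 2 = k * (w - u) * (w - v)) :
    f r / κ (ψ r) = f s / κ (ψ s) := by
  obtain ⟨g, hg, hgw⟩ := h
  obtain ⟨c, hc⟩ := IsSquare.exists_sq k (Complex.isSquare k)
  have hc0 : c ≠ 0 := by
    rintro rfl
    exact hk (by simp [hc])
  let q : ℂ → ℂ := fun w ↦ c * (w - v) * Complex.exp (g w / 2)
  have hq : ContinuousOn q (C ∪ ψ '' Set.Icc r s) := by fun_prop
  have hq2 : ∀ w ∈ C ∪ ψ '' Set.Icc r s, q w ^ 2 = k * (w - u) * (w - v) := by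
    intro w hw
    have : Complex.exp (g w / 2) ^ 2 = Complex.exp (g w) := by
      rw [← Complex.exp_nat_mul]
      congr 1
      push_cast
      ring
    simp only [q, mul_pow, this, ← hgw w hw, hc]
    ring
  have hq0 : ∀ w ∈ C ∪ ψ '' Set.Icc r s, q w ≠ 0 := fun w hw ↦
    mul_ne_zero (mul_ne_zero hc0 (sub_ne_zero.2 fun h ↦ hv (h ▸ hw))) (Complex.exp_ne_zero _)
  have hmem : ∀ t ∈ Set.Icc r s, ψ t ∈ C ∪ ψ '' Set.Icc r s := fun t ht ↦ Or.inr ⟨t, ht, rfl⟩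
  have h1 := isPreconnected_Icc.eq_or_eq_neg_of_sq_eq hf
    (hq.comp hψ.continuousOn hmem) (fun t ht ↦ (hf2 t ht).trans (hq2 _ (hmem t ht)).symm)
    (fun ht ↦ hq0 _ (hmem _ ht))
  have h2 := hC.eq_or_eq_neg_of_sq_eq hκ (hq.mono Set.subset_union_left)
    (fun w hw ↦ (hκ2 w hw).trans (hq2 _ (Or.inl hw)).symm)
    (fun hw ↦ hq0 _ (Or.inl hw))
  have hr' : r ∈ Set.Icc r s := ⟨le_rfl, hrs⟩
  have hs' : s ∈ Set.Icc r s := ⟨hrs, le_rfl⟩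
  have n1 := hq0 _ (hmem r hr')
  have n2 := hq0 _ (hmem s hs')
  rcases h1 with h1 | h1 <;> rcases h2 with h2 | h2 <;>
    rw [h1 hr', h1 hs', h2 hr, h2 hs] <;> simp [n1, n2]

/-- A Jordan curve in the plane, parametrised by `ℝ` with period `1`. -/
structure IsPeriodicJordanCurve (ψ : ℝ → ℂ) : Prop where
  continuous : Continuous ψ
  periodic : ∀ t, ψ (t + 1) = ψ t
  ne : ∀ s t, s < t → t < s + 1 → ψ s ≠ ψ t

/-- Pairwise disjoint closed connected plane sets. -/
structure SeparatedContinua (A B C : Set ℂ) : Prop where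
  closed₁ : IsClosed A
  closed₂ : IsClosed B
  closed₃ : IsClosed C
  preconnected₁ : IsPreconnected A
  preconnected₂ : IsPreconnected B
  preconnected₃ : IsPreconnected C
  disjoint₁₂ : Disjoint A B
  disjoint₁₃ : Disjoint A C
  disjoint₂₃ : Disjoint B C

/-- A continuous square root on `cyclicPairs` of the difference of two points of the curve. -/
structure IsSqrtDifference (ψ : ℝ → ℂ) (σ : ℝ × ℝ → ℂ) : Prop where
  continuousOn : ContinuousOn σ cyclicPairs
  sq : ∀ p ∈ cyclicPairs, σ p ^ 2 = ψ p.2 - ψ p.1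
  shift : ∀ p ∈ cyclicPairs, σ (p.1 + 1, p.2 + 1) = -σ p

/-- A continuous square root on `A × B × C` of the product of the three differences. -/
structure IsSqrtTriple (A B C : Set ℂ) (κ : ℂ × ℂ × ℂ → ℂ) : Prop where
  continuousOn : ContinuousOn κ (A ×ˢ B ×ˢ C)
  sq : ∀ u ∈ A, ∀ v ∈ B, ∀ w ∈ C, κ (u, v, w) ^ 2 = (v - u) * (w - v) * (w - u)

/-- The sign comparing the square root along the curve with that on `A × B × C`. -/
noncomputable def tripleSign (ψ : ℝ → ℂ) (σ : ℝ × ℝ → ℂ) (κ : ℂ × ℂ × ℂ → ℂ) (x y z : ℝ) : ℂ :=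
  σ (x, y) * σ (y, z) * σ (x, z) / κ (ψ x, ψ y, ψ z)

theorem IsPeriodicJordanCurve.disjoint_image {ψ : ℝ → ℂ} (hψ : IsPeriodicJordanCurve ψ)
    {a b c d : ℝ} (hbc : b < c) (hda : d < a + 1) :
    Disjoint (ψ '' Set.Icc a b) (ψ '' Set.Icc c d) := by
  rw [Set.disjoint_left]
  rintro _ ⟨s, hs, rfl⟩ ⟨t, ht, hts⟩
  exact hψ.ne s t (by linarith [hs.2, ht.1]) (by linarith [hs.1, ht.2]) hts.symm

theorem disjoint_image_of_forall {ψ : ℝ → ℂ} {a b : ℝ} {C : Set ℂ}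
    (h : ∀ t ∈ Set.Icc a b, ψ t ∉ C) : Disjoint (ψ '' Set.Icc a b) C := by
  rw [Set.disjoint_left]
  rintro _ ⟨s, hs, rfl⟩
  exact h s hs

section

variable {ψ : ℝ → ℂ} {A B C : Set ℂ} {σ : ℝ × ℝ → ℂ} {κ : ℂ × ℂ × ℂ → ℂ}

theorem logEquiv_of_disjoint (hψ : IsPeriodicJordanCurve ψ) {D S : Set ℂ} (hD : IsClosed D)
    (hS : IsPreconnected S) {r s : ℝ} (h₁ : Disjoint S D) (h₂ : Disjoint S (ψ '' Set.Icc r s))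
    {u v : ℂ} (hu : u ∈ S) (hv : v ∈ S) :
    LogEquiv (D ∪ ψ '' Set.Icc r s) u v :=
  hS.logEquiv (hD.union (isCompact_Icc.image hψ.continuous).isClosed)
    (Set.disjoint_union_right.2 ⟨h₁, h₂⟩) hu hv

theorem tripleSign_move_third (hψ : IsPeriodicJordanCurve ψ) (hS : SeparatedContinua A B C)
    (hσ : IsSqrtDifference ψ σ) (hκ : IsSqrtTriple A B C κ) {x y r s : ℝ}
    (hxy : x < y) (hyr : y < r) (hrs : r ≤ s) (hsx : s < x + 1)
    (hx : ψ x ∈ A) (hy : ψ y ∈ B) (hr : ψ r ∈ C) (hs : ψ s ∈ C)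
    (h : LogEquiv (C ∪ ψ '' Set.Icc r s) (ψ x) (ψ y)) :
    tripleSign ψ σ κ x y r = tripleSign ψ σ κ x y s := by
  have hyC : ψ y ∉ C ∪ ψ '' Set.Icc r s := by
    rintro (h | ⟨t, ht, h⟩)
    · exact hS.disjoint₂₃.notMem_of_mem_left hy h
    · exact hψ.ne y t (by linarith [ht.1]) (by linarith [ht.2]) h.symm
  have m1 : (x, y) ∈ cyclicPairs := ⟨hxy, by simp only; linarith⟩
  have m2 : ∀ t ∈ Set.Icc r s, (y, t) ∈ cyclicPairs := fun t ht ↦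
    ⟨by simp only; linarith [ht.1], by simp only; linarith [ht.2]⟩
  have m3 : ∀ t ∈ Set.Icc r s, (x, t) ∈ cyclicPairs := fun t ht ↦
    ⟨by simp only; linarith [ht.1], by simp only; linarith [ht.2]⟩
  refine ratio_eq_of_logEquiv (f := fun t ↦ σ (x, y) * σ (y, t) * σ (x, t))
    (κ := fun w ↦ κ (ψ x, ψ y, w)) hψ.continuous hS.preconnected₃ hrs hr hs
    (k := ψ y - ψ x) (sub_ne_zero.2 (hψ.ne x y hxy m1.2).symm) h hyC ?_ ?_ ?_ ?_
  · exact (continuousOn_const.mul (hσ.continuousOn.comp (by fun_prop) m2)).mul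
      (hσ.continuousOn.comp (by fun_prop) m3)
  · exact hκ.continuousOn.comp (by fun_prop) fun w hw ↦ ⟨hx, hy, hw⟩
  · intro t ht
    simp only [mul_pow, hσ.sq _ m1, hσ.sq _ (m2 t ht), hσ.sq _ (m3 t ht)]
    ring
  · intro w hw
    simp only [hκ.sq _ hx _ hy _ hw]
    ring

theorem tripleSign_move_second (hψ : IsPeriodicJordanCurve ψ) (hS : SeparatedContinua A B C)
    (hσ : IsSqrtDifference ψ σ) (hκ : IsSqrtTriple A B C κ) {x z r s : ℝ}
    (hxr : x < r) (hrs : r ≤ s) (hsz : s < z) (hzx : z < x + 1)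
    (hx : ψ x ∈ A) (hz : ψ z ∈ C) (hr : ψ r ∈ B) (hs : ψ s ∈ B)
    (h : LogEquiv (B ∪ ψ '' Set.Icc r s) (ψ x) (ψ z)) :
    tripleSign ψ σ κ x r z = tripleSign ψ σ κ x s z := by
  have hzC : ψ z ∉ B ∪ ψ '' Set.Icc r s := by
    rintro (h | ⟨t, ht, h⟩)
    · exact hS.disjoint₂₃.notMem_of_mem_left h hz
    · exact hψ.ne t z (by linarith [ht.2]) (by linarith [ht.1]) h
  have m1 : (x, z) ∈ cyclicPairs := ⟨by simp only; linarith, hzx⟩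
  have m2 : ∀ t ∈ Set.Icc r s, (x, t) ∈ cyclicPairs := fun t ht ↦
    ⟨by simp only; linarith [ht.1], by simp only; linarith [ht.2]⟩
  have m3 : ∀ t ∈ Set.Icc r s, (t, z) ∈ cyclicPairs := fun t ht ↦
    ⟨by simp only; linarith [ht.2], by simp only; linarith [ht.1]⟩
  refine ratio_eq_of_logEquiv (f := fun t ↦ σ (x, t) * σ (t, z) * σ (x, z))
    (κ := fun w ↦ κ (ψ x, w, ψ z)) hψ.continuous hS.preconnected₂ hrs hr hs
    (k := ψ x - ψ z) (sub_ne_zero.2 (hψ.ne x z m1.1 m1.2)) h hzC ?_ ?_ ?_ ?_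
  · exact ((hσ.continuousOn.comp (by fun_prop) m2).mul
      (hσ.continuousOn.comp (by fun_prop) m3)).mul continuousOn_const
  · exact hκ.continuousOn.comp (by fun_prop) fun w hw ↦ ⟨hx, hw, hz⟩
  · intro t ht
    simp only [mul_pow, hσ.sq _ m1, hσ.sq _ (m2 t ht), hσ.sq _ (m3 t ht)]
    ring
  · intro w hw
    simp only [hκ.sq _ hx _ hw _ hz]
    ring

theorem tripleSign_move_first (hψ : IsPeriodicJordanCurve ψ) (hS : SeparatedContinua A B C)
    (hσ : IsSqrtDifference ψ σ) (hκ : IsSqrtTriple A B C κ) {y z r s : ℝ}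
    (hrs : r ≤ s) (hsy : s < y) (hyz : y < z) (hzr : z < r + 1)
    (hy : ψ y ∈ B) (hz : ψ z ∈ C) (hr : ψ r ∈ A) (hs : ψ s ∈ A)
    (h : LogEquiv (A ∪ ψ '' Set.Icc r s) (ψ y) (ψ z)) :
    tripleSign ψ σ κ r y z = tripleSign ψ σ κ s y z := by
  have hzC : ψ z ∉ A ∪ ψ '' Set.Icc r s := by
    rintro (h | ⟨t, ht, h⟩)
    · exact hS.disjoint₁₃.notMem_of_mem_left h hz
    · exact hψ.ne t z (by linarith [ht.2]) (by linarith [ht.1]) h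
  have m1 : (y, z) ∈ cyclicPairs := ⟨hyz, by simp only; linarith⟩
  have m2 : ∀ t ∈ Set.Icc r s, (t, y) ∈ cyclicPairs := fun t ht ↦
    ⟨by simp only; linarith [ht.2], by simp only; linarith [ht.1]⟩
  have m3 : ∀ t ∈ Set.Icc r s, (t, z) ∈ cyclicPairs := fun t ht ↦
    ⟨by simp only; linarith [ht.2], by simp only; linarith [ht.1]⟩
  refine ratio_eq_of_logEquiv (f := fun t ↦ σ (t, y) * σ (y, z) * σ (t, z))
    (κ := fun w ↦ κ (w, ψ y, ψ z)) hψ.continuous hS.preconnected₁ hrs hr hs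
    (k := ψ z - ψ y) (sub_ne_zero.2 (hψ.ne y z m1.1 m1.2).symm) h hzC ?_ ?_ ?_ ?_
  · exact ((hσ.continuousOn.comp (by fun_prop) m2).mul continuousOn_const).mul
      (hσ.continuousOn.comp (by fun_prop) m3)
  · exact hκ.continuousOn.comp (by fun_prop) fun w hw ↦ ⟨hw, hy, hz⟩
  · intro t ht
    simp only [mul_pow, hσ.sq _ m1, hσ.sq _ (m2 t ht), hσ.sq _ (m3 t ht)]
    ring
  · intro w hw
    simp only [hκ.sq _ hw _ hy _ hz]
    ring

theorem tripleSign_sq (hψ : IsPeriodicJordanCurve ψ)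
    (hσ : IsSqrtDifference ψ σ) (hκ : IsSqrtTriple A B C κ) {x y z : ℝ}
    (hxy : x < y) (hyz : y < z) (hzx : z < x + 1)
    (hx : ψ x ∈ A) (hy : ψ y ∈ B) (hz : ψ z ∈ C) : tripleSign ψ σ κ x y z ^ 2 = 1 := by
  have m1 : (x, y) ∈ cyclicPairs := ⟨hxy, by simp only; linarith⟩
  have m2 : (y, z) ∈ cyclicPairs := ⟨hyz, by simp only; linarith⟩
  have m3 : (x, z) ∈ cyclicPairs := ⟨by simp only; linarith, hzx⟩
  rw [tripleSign, div_pow, mul_pow, mul_pow, hκ.sq _ hx _ hy _ hz, hσ.sq _ m1, hσ.sq _ m2,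
    hσ.sq _ m3]
  refine div_self (mul_ne_zero (mul_ne_zero ?_ ?_) ?_) <;> refine sub_ne_zero.2 (Ne.symm ?_)
  exacts [hψ.ne _ _ m1.1 m1.2, hψ.ne _ _ m2.1 m2.2, hψ.ne _ _ m3.1 m3.2]

theorem tripleSign_shift (hψ : IsPeriodicJordanCurve ψ)
    (hσ : IsSqrtDifference ψ σ) {x y z : ℝ} (hxy : x < y) (hyz : y < z) (hzx : z < x + 1) :
    tripleSign ψ σ κ (x + 1) (y + 1) (z + 1) = -tripleSign ψ σ κ x y z := by
  have m1 : (x, y) ∈ cyclicPairs := ⟨hxy, by simp only; linarith⟩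
  have m2 : (y, z) ∈ cyclicPairs := ⟨hyz, by simp only; linarith⟩
  have m3 : (x, z) ∈ cyclicPairs := ⟨by simp only; linarith, hzx⟩
  have h1 := hσ.shift _ m1
  have h2 := hσ.shift _ m2
  have h3 := hσ.shift _ m3
  simp only at h1 h2 h3
  simp only [tripleSign, hψ.periodic, h1, h2, h3]
  ring

end

section

variable {ψ : ℝ → ℂ} {A B C : Set ℂ} {σ : ℝ × ℝ → ℂ} {κ : ℂ × ℂ × ℂ → ℂ}

/-- If every excursion of the curve from `C` during `[z, w]` avoids `A` or `B`, then moving the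
third point from `z` to `w` does not change the sign. -/
theorem tripleSign_move_third_of_excursions (hψ : IsPeriodicJordanCurve ψ)
    (hS : SeparatedContinua A B C) (hσ : IsSqrtDifference ψ σ) (hκ : IsSqrtTriple A B C κ)
    {x y z w : ℝ} (hxy : x < y) (hyz : y < z) (hzw : z ≤ w) (hwx : w < x + 1)
    (hx : ψ x ∈ A) (hy : ψ y ∈ B) (hz : ψ z ∈ C) (hw : ψ w ∈ C)
    (h : ∀ r s, z ≤ r → r < s → s ≤ w → ψ r ∈ C → ψ s ∈ C → (∀ t ∈ Set.Ioo r s, ψ t ∉ C) →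
      LogEquiv (C ∪ ψ '' Set.Icc r s) (ψ x) (ψ y)) :
    tripleSign ψ σ κ x y z = tripleSign ψ σ κ x y w := by
  set E : ℝ → ℂ := fun t ↦ tripleSign ψ σ κ x y t with hE
  let H : Set ℝ := Set.Icc z w ∩ ψ ⁻¹' C
  have hH : IsCompact H := isCompact_Icc.inter_right (hS.closed₃.preimage hψ.continuous)
  have hE2 : ∀ t ∈ H, E t ^ 2 = 1 := fun t ht ↦
    tripleSign_sq hψ hσ hκ hxy (by linarith [ht.1.1]) (by linarith [ht.1.2]) hx hy ht.2
  have hEc : ContinuousOn E H := by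
    refine ContinuousOn.div ((continuousOn_const.mul (hσ.continuousOn.comp (by fun_prop) ?_)).mul
      (hσ.continuousOn.comp (by fun_prop) ?_)) (hκ.continuousOn.comp ?_ ?_) ?_
    · exact fun t ht ↦ ⟨by simp only; linarith [ht.1.1], by simp only; linarith [ht.1.2]⟩
    · exact fun t ht ↦ ⟨by simp only; linarith [ht.1.1], by simp only; linarith [ht.1.2]⟩
    · have := hψ.continuous
      fun_prop
    · exact fun t ht ↦ ⟨hx, hy, ht.2⟩
    · intro t ht h0
      have := hE2 t ht
      simp [hE, tripleSign, h0] at this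
  let G : Set ℝ := H ∩ E ⁻¹' {E z}
  have hG : IsCompact G := hH.of_isClosed_subset
    (hEc.preimage_isClosed_of_isClosed hH.isClosed isClosed_singleton) Set.inter_subset_left
  have hzH : z ∈ H := ⟨⟨le_rfl, hzw⟩, hz⟩
  obtain ⟨r, ⟨hrH, hrE⟩, hrmax⟩ := hG.exists_isGreatest ⟨z, hzH, rfl⟩
  simp only [Set.mem_preimage, Set.mem_singleton_iff] at hrE
  rcases hrH.1.2.eq_or_lt with rfl | hrw
  · exact hrE.symm
  exfalso
  have hev : ∀ᶠ t in 𝓝[H] r, E t ≠ -E r := by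
    refine (hEc r hrH).eventually_ne ?_
    intro h0
    have h1 : E r = 0 := by linear_combination h0 / 2
    have := hE2 r hrH
    simp [h1] at this
  rw [eventually_nhdsWithin_iff, Metric.eventually_nhds_iff] at hev
  obtain ⟨ε, hε, hev⟩ := hev
  have hgap : ∀ t ∈ H, r < t → r + ε ≤ t := by
    intro t ht hrt
    by_contra! hlt
    have h1 := hev (y := t) (by rw [Real.dist_eq, abs_lt]; constructor <;> linarith) ht
    have h2 : E t = E r :=
      (sq_eq_sq_iff_eq_or_eq_neg.1 ((hE2 t ht).trans (hE2 r hrH).symm)).resolve_right h1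
    exact absurd (hrmax ⟨ht, h2.trans hrE⟩) (by linarith)
  have hwH : w ∈ H := ⟨⟨hzw, le_rfl⟩, hw⟩
  obtain ⟨s, ⟨hsH, hrs⟩, hsmin⟩ := (hH.inter_right isClosed_Ici).exists_isLeast
    (s := H ∩ Set.Ici (r + ε)) ⟨w, hwH, hgap w hwH hrw⟩
  simp only [Set.mem_Ici] at hrs
  have hrs' : r < s := by linarith
  have hlog := h r s hrH.1.1 hrs' hsH.1.2 hrH.2 hsH.2 (by
    intro t ht htC
    have htH : t ∈ H := ⟨⟨hrH.1.1.trans ht.1.le, ht.2.le.trans hsH.1.2⟩, htC⟩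
    exact absurd (hsmin ⟨htH, hgap t htH ht.1⟩) (by linarith [ht.2]))
  have hEE : E r = E s := tripleSign_move_third hψ hS hσ hκ hxy (by linarith [hrH.1.1]) hrs'.le
    (by linarith [hsH.1.2]) hx hy hrH.2 hsH.2 hlog
  exact absurd (hrmax ⟨hsH, hEE.symm.trans hrE⟩) (by linarith)

theorem tripleSign_half_turn (hψ : IsPeriodicJordanCurve ψ)
    (hS : SeparatedContinua A B C) (hσ : IsSqrtDifference ψ σ) (hκ : IsSqrtTriple A B C κ)
    {x₁ y₁ z₁ x₂ y₂ z₂ : ℝ} (hxy₁ : x₁ < y₁) (hyz₁ : y₁ < z₁) (hzx₁ : z₁ < x₂) (hxy₂ : x₂ < y₂)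
    (hyz₂ : y₂ < z₂) (hzx₂ : z₂ < x₁ + 1)
    (hx₁ : ψ x₁ ∈ A) (hy₁ : ψ y₁ ∈ B) (hz₁ : ψ z₁ ∈ C)
    (hx₂ : ψ x₂ ∈ A) (hy₂ : ψ y₂ ∈ B) (hz₂ : ψ z₂ ∈ C)
    (hfirst : ∀ t ∈ Set.Ico y₂ z₂, ψ t ∉ C)
    (hav₁ : ∀ t ∈ Set.Icc x₁ y₁, ψ t ∉ C) (hav₂ : ∀ t ∈ Set.Icc x₂ y₂, ψ t ∉ C)
    (hBA : ∀ s t, s < t → t < s + 1 → ψ s ∈ B → ψ t ∈ A → ∃ r ∈ Set.Icc s t, ψ r ∈ C)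
    (hAB : ∀ s t, y₂ ≤ s → s ≤ t → t ≤ x₁ + 1 → ψ s ∈ A → ψ t ∈ B →
      ∃ r ∈ Set.Icc s t, ψ r ∈ C) :
    tripleSign ψ σ κ x₁ y₁ z₁ = tripleSign ψ σ κ x₂ y₂ z₂ := by
  have hx₁' : ψ (x₁ + 1) ∈ A := by rwa [hψ.periodic]
  obtain ⟨w, ⟨hwI, hwC⟩, hwmax⟩ := (isCompact_Icc.inter_right
    (hS.closed₃.preimage hψ.continuous)).exists_isGreatest
    (s := Set.Icc z₂ (x₁ + 1) ∩ ψ ⁻¹' C) ⟨z₂, ⟨le_rfl, hzx₂.le⟩, hz₂⟩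
  simp only [Set.mem_preimage] at hwC
  have hwx : w < x₁ + 1 := hwI.2.lt_of_ne fun h ↦ by
    subst h
    exact hS.disjoint₁₃.notMem_of_mem_left hx₁' hwC
  have hzw : z₂ ≤ w := hwI.1
  have hwB : ∀ t ∈ Set.Icc w (x₁ + 1), ψ t ∉ B := by
    intro t ht htB
    have h1 : t < x₁ + 1 := ht.2.lt_of_ne fun h ↦ by
      subst h
      exact hS.disjoint₁₂.notMem_of_mem_left hx₁' htB
    obtain ⟨r, hr, hrC⟩ := hBA t (x₁ + 1) h1 (by linarith [ht.1]) htB hx₁'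
    have h2 : r ≤ w := hwmax ⟨⟨by linarith [hr.1, ht.1], hr.2⟩, hrC⟩
    have h3 : t = r := le_antisymm hr.1 (h2.trans ht.1)
    subst h3
    exact hS.disjoint₂₃.notMem_of_mem_left htB hrC
  have hyA : ∀ t ∈ Set.Icc y₂ z₂, ψ t ∉ A := by
    intro t ht htA
    have h1 : y₂ < t := ht.1.lt_of_ne fun h ↦ by
      subst h
      exact hS.disjoint₁₂.notMem_of_mem_left htA hy₂
    obtain ⟨r, hr, hrC⟩ := hBA y₂ t h1 (by linarith [ht.2]) hy₂ htA
    have h2 : ¬ r < z₂ := fun h ↦ hfirst r ⟨hr.1, h⟩ hrC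
    have h3 : t = r := le_antisymm (by linarith [ht.2]) hr.2
    subst h3
    exact hS.disjoint₁₃.notMem_of_mem_left htA hrC
  have conn : ∀ a b, IsPreconnected (ψ '' Set.Icc a b) := fun a b ↦
    isPreconnected_Icc.image _ hψ.continuous.continuousOn
  have mem_left : ∀ {a b}, a ≤ b → ψ a ∈ ψ '' Set.Icc a b := fun h ↦ ⟨_, ⟨le_rfl, h⟩, rfl⟩
  have mem_right : ∀ {a b}, a ≤ b → ψ b ∈ ψ '' Set.Icc a b := fun h ↦ ⟨_, ⟨h, le_rfl⟩, rfl⟩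
  calc tripleSign ψ σ κ x₁ y₁ z₁
      = tripleSign ψ σ κ x₁ y₁ w :=
        tripleSign_move_third hψ hS hσ hκ hxy₁ hyz₁ (by linarith) hwx hx₁ hy₁ hz₁ hwC
          (logEquiv_of_disjoint hψ hS.closed₃ (conn x₁ y₁) (disjoint_image_of_forall hav₁)
            (hψ.disjoint_image hyz₁ (by linarith)) (mem_left hxy₁.le) (mem_right hxy₁.le))
    _ = tripleSign ψ σ κ x₁ y₂ w :=
        tripleSign_move_second hψ hS hσ hκ hxy₁ (by linarith) (by linarith) hwx hx₁ hwC hy₁ hy₂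
          (logEquiv_of_disjoint hψ hS.closed₂ (conn w (x₁ + 1)) (disjoint_image_of_forall hwB)
            (hψ.disjoint_image (by linarith) (by linarith)).symm
            (by simpa only [hψ.periodic] using mem_right hwx.le) (mem_left hwx.le))
    _ = tripleSign ψ σ κ x₁ y₂ z₂ := by
        refine (tripleSign_move_third_of_excursions hψ hS hσ hκ (by linarith) hyz₂ hzw hwx
          hx₁ hy₂ hz₂ hwC fun r s hzr hrs hsw hr hs hgap ↦ ?_).symm
        have arc₁ : LogEquiv (C ∪ ψ '' Set.Icc r s) (ψ x₁) (ψ y₁) :=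
          logEquiv_of_disjoint hψ hS.closed₃ (conn x₁ y₁) (disjoint_image_of_forall hav₁)
            (hψ.disjoint_image (by linarith) (by linarith)) (mem_left hxy₁.le) (mem_right hxy₁.le)
        have arc₂ : LogEquiv (C ∪ ψ '' Set.Icc r s) (ψ x₂) (ψ y₂) :=
          logEquiv_of_disjoint hψ hS.closed₃ (conn x₂ y₂) (disjoint_image_of_forall hav₂)
            (hψ.disjoint_image (by linarith) (by linarith)) (mem_left hxy₂.le) (mem_right hxy₂.le)
        have hIoo : ∀ D : Set ℂ, Disjoint D C → ∀ t ∈ Set.Icc r s, ψ t ∈ D → t ∈ Set.Ioo r s := by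
          intro D hD t ht htD
          refine ⟨ht.1.lt_of_ne ?_, ht.2.lt_of_ne ?_⟩ <;> rintro rfl
          exacts [hD.notMem_of_mem_left htD hr, hD.notMem_of_mem_left htD hs]
        have hor : (∀ t ∈ Set.Icc r s, ψ t ∉ A) ∨ (∀ t ∈ Set.Icc r s, ψ t ∉ B) := by
          by_contra! hcon
          obtain ⟨⟨t, ht, htA⟩, ⟨t', ht', htB⟩⟩ := hcon
          have i := hIoo A hS.disjoint₁₃ t ht htA
          have i' := hIoo B hS.disjoint₂₃ t' ht' htB
          rcases lt_trichotomy t t' with hlt | rfl | hlt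
          · obtain ⟨c, hc, hcC⟩ := hAB t t' (by linarith [ht.1]) hlt.le (by linarith [ht'.2]) htA htB
            exact hgap c ⟨by linarith [i.1, hc.1], by linarith [i'.2, hc.2]⟩ hcC
          · exact hS.disjoint₁₂.notMem_of_mem_left htA htB
          · obtain ⟨c, hc, hcC⟩ := hBA t' t hlt (by linarith [ht.2, ht'.1]) htB htA
            exact hgap c ⟨by linarith [i'.1, hc.1], by linarith [i.2, hc.2]⟩ hcC
        rcases hor with hA | hB
        · exact (logEquiv_of_disjoint hψ hS.closed₃ hS.preconnected₁ hS.disjoint₁₃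
            (disjoint_image_of_forall hA).symm hx₁ hx₂).trans arc₂
        · exact arc₁.trans (logEquiv_of_disjoint hψ hS.closed₃ hS.preconnected₂ hS.disjoint₂₃
            (disjoint_image_of_forall hB).symm hy₁ hy₂)
    _ = tripleSign ψ σ κ x₂ y₂ z₂ :=
        tripleSign_move_first hψ hS hσ hκ (by linarith) hxy₂ hyz₂ hzx₂ hy₂ hz₂ hx₁ hx₂
          (logEquiv_of_disjoint hψ hS.closed₁ (conn y₂ z₂) (disjoint_image_of_forall hyA)
            (hψ.disjoint_image hxy₂ (by linarith)).symm (mem_left hyz₂.le) (mem_right hyz₂.le))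

theorem false_of_two_parallel_arcs (hψ : IsPeriodicJordanCurve ψ)
    (hS : SeparatedContinua A B C) (hσ : IsSqrtDifference ψ σ) (hκ : IsSqrtTriple A B C κ)
    {x₁ y₁ x₂ y₂ : ℝ} (hxy₁ : x₁ < y₁) (hyx₁ : y₁ < x₂) (hxy₂ : x₂ < y₂) (hyx₂ : y₂ < x₁ + 1)
    (hx₁ : ψ x₁ ∈ A) (hy₁ : ψ y₁ ∈ B) (hx₂ : ψ x₂ ∈ A) (hy₂ : ψ y₂ ∈ B)
    (hav₁ : ∀ t ∈ Set.Icc x₁ y₁, ψ t ∉ C) (hav₂ : ∀ t ∈ Set.Icc x₂ y₂, ψ t ∉ C)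
    (hBA : ∀ s t, s < t → t < s + 1 → ψ s ∈ B → ψ t ∈ A → ∃ r ∈ Set.Icc s t, ψ r ∈ C)
    (hAB₁ : ∀ s t, y₁ ≤ s → s ≤ t → t ≤ x₂ → ψ s ∈ A → ψ t ∈ B → ∃ r ∈ Set.Icc s t, ψ r ∈ C)
    (hAB₂ : ∀ s t, y₂ ≤ s → s ≤ t → t ≤ x₁ + 1 → ψ s ∈ A → ψ t ∈ B →
      ∃ r ∈ Set.Icc s t, ψ r ∈ C) : False := by
  have hper := hψ.periodic
  have first : ∀ y x, y < x → x < y + 1 → ψ y ∈ B → ψ x ∈ A →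
      ∃ z, y < z ∧ z < x ∧ ψ z ∈ C ∧ ∀ t ∈ Set.Ico y z, ψ t ∉ C := by
    intro y x hyx hxy hy hx
    obtain ⟨r, hr, hrC⟩ := hBA y x hyx hxy hy hx
    obtain ⟨z, ⟨hzI, hzC⟩, hzmin⟩ := (isCompact_Icc.inter_right
      (hS.closed₃.preimage hψ.continuous)).exists_isLeast
      (s := Set.Icc y x ∩ ψ ⁻¹' C) ⟨r, hr, hrC⟩
    simp only [Set.mem_preimage] at hzC
    refine ⟨z, hzI.1.lt_of_ne ?_, hzI.2.lt_of_ne ?_, hzC, fun t ht htC ↦ ?_⟩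
    · rintro rfl
      exact hS.disjoint₂₃.notMem_of_mem_left hy hzC
    · rintro rfl
      exact hS.disjoint₁₃.notMem_of_mem_left hx hzC
    · exact absurd (hzmin ⟨⟨ht.1, ht.2.le.trans hzI.2⟩, htC⟩) (not_le.2 ht.2)
  obtain ⟨z₁, hyz₁, hzx₁, hz₁, hf₁⟩ := first y₁ x₂ hyx₁ (by linarith) hy₁ hx₂
  obtain ⟨z₂, hyz₂, hzx₂, hz₂, hf₂⟩ := first y₂ (x₁ + 1) hyx₂ (by linarith) hy₂ (by rwa [hper])
  have hback : ∀ t, ψ (t - 1) = ψ t := fun t ↦ by rw [← hper (t - 1), sub_add_cancel]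
  have e₁ := tripleSign_half_turn hψ hS hσ hκ hxy₁ hyz₁ hzx₁ hxy₂ hyz₂ hzx₂ hx₁ hy₁ hz₁ hx₂ hy₂ hz₂
    hf₂ hav₁ hav₂ hBA hAB₂
  have e₂ := tripleSign_half_turn hψ hS hσ hκ (x₂ := x₁ + 1) (y₂ := y₁ + 1) (z₂ := z₁ + 1)
    hxy₂ hyz₂ hzx₂ (by linarith) (by linarith) (by linarith) hx₂ hy₂ hz₂
    (by rwa [hper]) (by rwa [hper]) (by rwa [hper])
    (fun t ht ↦ hback t ▸ hf₁ (t - 1) ⟨by linarith [ht.1], by linarith [ht.2]⟩) hav₂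
    (fun t ht ↦ hback t ▸ hav₁ (t - 1) ⟨by linarith [ht.1], by linarith [ht.2]⟩) hBA
    (by
      intro s t hs hst ht hsA htB
      obtain ⟨r, hr, hrC⟩ := hAB₁ (s - 1) (t - 1) (by linarith) (by linarith) (by linarith)
        (by rwa [hback]) (by rwa [hback])
      exact ⟨r + 1, ⟨by linarith [hr.1], by linarith [hr.2]⟩, by rwa [hper]⟩)
  have e₃ := tripleSign_shift (κ := κ) hψ hσ hxy₁ hyz₁ (by linarith)
  have e₄ := tripleSign_sq hψ hσ hκ hxy₁ hyz₁ (by linarith) hx₁ hy₁ hz₁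
  have e₅ : tripleSign ψ σ κ x₁ y₁ z₁ = 0 := by
    linear_combination (e₁ + e₂ + e₃) / 2
  simp [e₅] at e₄

end

theorem IsCompact.contractibleSpace_image {X Y : Type*} [TopologicalSpace X] [TopologicalSpace Y]
    [T2Space Y] {K : Set X} (hK : IsCompact K) [ContractibleSpace K] {f : X → Y}
    (hf : ContinuousOn f K) (hinj : Set.InjOn f K) : ContractibleSpace (f '' K) := by
  have := isCompact_iff_compactSpace.1 hK
  let e : K ≃ f '' K := hinj.bijOn_image.equiv f
  have he : Continuous e := by
    refine Continuous.subtype_mk ?_ _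
    exact hf.domRestrict
  exact (he.homeoOfEquivCompactToT2 (f := e)).symm.contractibleSpace

theorem IsSqrtTriple.exists {A B C : Set ℂ} [ContractibleSpace A] [ContractibleSpace B]
    [ContractibleSpace C] (hAB : Disjoint A B) (hAC : Disjoint A C) (hBC : Disjoint B C) :
    ∃ κ, IsSqrtTriple A B C κ := by
  have : ContractibleSpace ↥(B ×ˢ C) := (Homeomorph.Set.prod B C).contractibleSpace
  have : ContractibleSpace ↥(A ×ˢ B ×ˢ C) := (Homeomorph.Set.prod A (B ×ˢ C)).contractibleSpace
  obtain ⟨g, hg, hgf⟩ := exists_continuousOn_log (A ×ˢ B ×ˢ C)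
    (f := fun p : ℂ × ℂ × ℂ ↦ (p.2.1 - p.1) * (p.2.2 - p.2.1) * (p.2.2 - p.1)) (by fun_prop) (by
      rintro ⟨u, v, w⟩ ⟨hu, hv, hw⟩
      exact mul_ne_zero (mul_ne_zero (sub_ne_zero.2 (hAB.ne_of_mem hu hv).symm)
        (sub_ne_zero.2 (hBC.ne_of_mem hv hw).symm)) (sub_ne_zero.2 (hAC.ne_of_mem hu hw).symm))
  refine ⟨fun p ↦ Complex.exp (g p / 2), by fun_prop, fun u hu v hv w hw ↦ ?_⟩
  rw [← hgf (u, v, w) ⟨hu, hv, hw⟩, ← Complex.exp_nat_mul]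
  congr 1
  push_cast
  ring

/-- `(x, y, τ)` describes a piece of the curve `ψ` from `a τ` to `B` that avoids `C`. -/
structure IsConnection (ψ a : ℝ → ℂ) (B C : Set ℂ) (p : ℝ × ℝ × ℝ) : Prop where
  le : p.1 ≤ p.2.1
  mem_Icc : p.2.2 ∈ Set.Icc (0 : ℝ) 1
  left : ψ p.1 = a p.2.2
  right : ψ p.2.1 ∈ B
  avoids : ∀ t, ψ t ∈ C → t ≤ p.1 ∨ p.2.1 ≤ t

theorem isClosed_isConnection {ψ a : ℝ → ℂ} {B C : Set ℂ} (hψ : Continuous ψ) (ha : Continuous a)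
    (hB : IsClosed B) : IsClosed {p | IsConnection ψ a B C p} := by
  have : {p | IsConnection ψ a B C p} = {p : ℝ × ℝ × ℝ | p.1 ≤ p.2.1} ∩
      {p | p.2.2 ∈ Set.Icc (0 : ℝ) 1} ∩ {p | ψ p.1 = a p.2.2} ∩ {p | ψ p.2.1 ∈ B} ∩
      ⋂ t ∈ ψ ⁻¹' C, ({p | t ≤ p.1} ∪ {p | p.2.1 ≤ t}) := by
    ext p
    simp only [Set.mem_inter_iff, Set.mem_iInter, Set.mem_union, Set.mem_ofPred_eq,
      Set.mem_preimage]
    exact ⟨fun h ↦ ⟨⟨⟨⟨h.1, h.2⟩, h.3⟩, h.4⟩, h.5⟩, fun h ↦ ⟨h.1.1.1.1, h.1.1.1.2, h.1.1.2, h.1.2,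
      h.2⟩⟩
  rw [this]
  refine ((((isClosed_le (by fun_prop) (by fun_prop)).inter
    (isClosed_Icc.preimage (by fun_prop))).inter (isClosed_eq (by fun_prop) (by fun_prop))).inter
    (hB.preimage (by fun_prop))).inter (isClosed_biInter fun t _ ↦
      (isClosed_le (by fun_prop) (by fun_prop)).union (isClosed_le (by fun_prop) (by fun_prop)))

/-- Two successive connections within one period of the curve. -/
structure IsConnectionPair (ψ a : ℝ → ℂ) (B C : Set ℂ) (q : (ℝ × ℝ × ℝ) × (ℝ × ℝ × ℝ)) :
    Prop where
  fst : IsConnection ψ a B C q.1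
  snd : IsConnection ψ a B C q.2
  le : q.1.2.1 ≤ q.2.1
  le_add_one : q.2.2.1 ≤ q.1.1 + 1

theorem IsConnection.shift {ψ a : ℝ → ℂ} {B C : Set ℂ} (hper : ∀ t, ψ (t + 1) = ψ t)
    {x y τ : ℝ} (h : IsConnection ψ a B C (x, y, τ)) (n : ℤ) :
    IsConnection ψ a B C (x + n, y + n, τ) := by
  have hper' : ∀ t, ψ (t + n) = ψ t := by
    have : Function.Periodic ψ 1 := hper
    simpa using this.int_mul n
  refine ⟨by simpa using h.le, h.mem_Icc, (hper' x).trans h.left, ?_, fun t ht ↦ ?_⟩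
  · simpa [hper'] using h.right
  · have := h.avoids (t - n) (by rwa [← hper', sub_add_cancel])
    simpa [sub_le_iff_le_add, le_sub_iff_add_le] using this

theorem IsConnectionPair.rotate {ψ a : ℝ → ℂ} {B C : Set ℂ} (hper : ∀ t, ψ (t + 1) = ψ t)
    {x₁ y₁ τ₁ x₂ y₂ τ₂ : ℝ} (h : IsConnectionPair ψ a B C ((x₁, y₁, τ₁), (x₂, y₂, τ₂))) :
    IsConnectionPair ψ a B C ((x₂, y₂, τ₂), (x₁ + 1, y₁ + 1, τ₁)) :=
  ⟨h.snd, by simpa using h.fst.shift hper 1, h.le_add_one, by simpa using h.le⟩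

/-- Among all pairs of connections there is one whose starting points are closest on `a`. -/
theorem IsConnectionPair.exists_min {ψ a : ℝ → ℂ} {B C : Set ℂ} (hψ : Continuous ψ)
    (hper : ∀ t, ψ (t + 1) = ψ t) (ha : Continuous a) (hB : IsClosed B)
    (h : ∃ q, IsConnectionPair ψ a B C q) :
    ∃ q, IsConnectionPair ψ a B C q ∧ ∀ q', IsConnectionPair ψ a B C q' →
      |q.1.2.2 - q.2.2.2| ≤ |q'.1.2.2 - q'.2.2.2| := by
  let P : Set ((ℝ × ℝ × ℝ) × (ℝ × ℝ × ℝ)) :=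
    {q | IsConnectionPair ψ a B C q} ∩ {q | q.1.1 ∈ Set.Icc (0 : ℝ) 1}
  have hclosed : IsClosed P := by
    have : {q | IsConnectionPair ψ a B C q} = Prod.fst ⁻¹' {p | IsConnection ψ a B C p} ∩
        Prod.snd ⁻¹' {p | IsConnection ψ a B C p} ∩ {q | q.1.2.1 ≤ q.2.1} ∩
        {q | q.2.2.1 ≤ q.1.1 + 1} := by
      ext q
      exact ⟨fun h ↦ ⟨⟨⟨h.1, h.2⟩, h.3⟩, h.4⟩, fun h ↦ ⟨h.1.1.1, h.1.1.2, h.1.2, h.2⟩⟩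
    have hS := isClosed_isConnection (C := C) hψ ha hB
    refine IsClosed.inter ?_ (isClosed_Icc.preimage (by fun_prop))
    rw [this]
    exact (((hS.preimage continuous_fst).inter (hS.preimage continuous_snd)).inter
      (isClosed_le (by fun_prop) (by fun_prop))).inter (isClosed_le (by fun_prop) (by fun_prop))
  have hcompact : IsCompact P := by
    refine (isCompact_Icc (a := (((0 : ℝ), (0 : ℝ), (0 : ℝ)), ((0 : ℝ), (0 : ℝ), (0 : ℝ))))
      (b := ((2, 2, 2), (2, 2, 2)))).of_isClosed_subset hclosed ?_
    rintro ⟨⟨x₁, y₁, τ₁⟩, ⟨x₂, y₂, τ₂⟩⟩ ⟨h, h0⟩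
    have h1 := h.fst.le
    have h2 := h.fst.mem_Icc
    have h3 := h.snd.le
    have h4 := h.snd.mem_Icc
    have h5 := h.le
    have h6 := h.le_add_one
    simp only [Set.mem_ofPred_eq, Set.mem_Icc, Prod.mk_le_mk] at *
    refine ⟨⟨⟨?_, ?_, ?_⟩, ?_, ?_, ?_⟩, ⟨?_, ?_, ?_⟩, ?_, ?_, ?_⟩ <;> linarith
  have hmove : ∀ q, IsConnectionPair ψ a B C q → ∃ q' ∈ P,
      |q'.1.2.2 - q'.2.2.2| = |q.1.2.2 - q.2.2.2| := by
    rintro ⟨⟨x₁, y₁, τ₁⟩, ⟨x₂, y₂, τ₂⟩⟩ h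
    refine ⟨((x₁ + (-⌊x₁⌋ : ℤ), y₁ + (-⌊x₁⌋ : ℤ), τ₁), (x₂ + (-⌊x₁⌋ : ℤ), y₂ + (-⌊x₁⌋ : ℤ), τ₂)),
      ⟨⟨h.fst.shift hper _, h.snd.shift hper _, ?_, ?_⟩, ?_, ?_⟩, rfl⟩
    · simpa using h.le
    · have := h.le_add_one
      simp only at this ⊢
      linarith
    · simp [Int.floor_le]
    · have := (Int.lt_floor_add_one x₁).le
      push_cast
      linarith
  obtain ⟨q₀, hq₀⟩ := h
  obtain ⟨q₁, hq₁, -⟩ := hmove q₀ hq₀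
  obtain ⟨q, hq, hmin⟩ := hcompact.exists_isMinOn ⟨q₁, hq₁⟩
    (f := fun q ↦ |q.1.2.2 - q.2.2.2|) (by fun_prop)
  refine ⟨q, hq.1, fun q' hq' ↦ ?_⟩
  obtain ⟨q₂, hq₂, he⟩ := hmove q' hq'
  exact he ▸ hmin hq₂

/-- In a closest pair, a piece of the curve between the two connections that runs from the
segment of `a` between their starting points to `B` meets `C`. -/
theorem IsConnectionPair.exists_mem_of_min {ψ a : ℝ → ℂ} {B C : Set ℂ}
    (hψ : IsPeriodicJordanCurve ψ) (hB : ∀ τ ∈ Set.Icc (0 : ℝ) 1, a τ ∉ B)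
    {x₁ y₁ τ₁ x₂ y₂ τ₂ : ℝ} (h : IsConnectionPair ψ a B C ((x₁, y₁, τ₁), (x₂, y₂, τ₂)))
    (hmin : ∀ q', IsConnectionPair ψ a B C q' → |τ₁ - τ₂| ≤ |q'.1.2.2 - q'.2.2.2|)
    {r₁ r₂ : ℝ} (h₁ : y₁ ≤ r₁) (h₁₂ : r₁ ≤ r₂) (h₂ : r₂ ≤ x₂)
    (hr₁ : ψ r₁ ∈ a '' Set.uIcc τ₁ τ₂) (hr₂ : ψ r₂ ∈ B) : ∃ r ∈ Set.Icc r₁ r₂, ψ r ∈ C := by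
  by_contra! hC
  obtain ⟨τ, hτ, hτr⟩ := hr₁
  have hc : IsConnection ψ a B C (r₁, r₂, τ) := by
    refine ⟨h₁₂, Set.uIcc_subset_Icc h.fst.mem_Icc h.snd.mem_Icc hτ, hτr.symm, hr₂, fun t ht ↦ ?_⟩
    by_contra! ht'
    exact hC t ⟨ht'.1.le, ht'.2.le⟩ ht
  have h3 := h.fst.le
  have h4 := h.snd.le
  have h5 := h.le_add_one
  simp only at h3 h4 h5
  have m1 := hmin ((x₁, y₁, τ₁), (r₁, r₂, τ)) ⟨h.fst, hc, h₁, by simp only; linarith⟩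
  have m2 := hmin ((r₁, r₂, τ), (x₂, y₂, τ₂)) ⟨hc, h.snd, h₂, by simp only; linarith⟩
  simp only at m1 m2
  have hsum : |τ₁ - τ| + |τ - τ₂| = |τ₁ - τ₂| := by
    rcases Set.mem_uIcc.1 hτ with ⟨h, h'⟩ | ⟨h, h'⟩
    · rw [abs_of_nonpos (by linarith), abs_of_nonpos (by linarith), abs_of_nonpos (by linarith)]
      ring
    · rw [abs_of_nonneg (by linarith), abs_of_nonneg (by linarith), abs_of_nonneg (by linarith)]
      ring
  have hτ₁₂ : τ₁ = τ₂ := by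
    have : |τ₁ - τ₂| ≤ 0 := by linarith
    simpa [sub_eq_zero] using this
  have hne : x₁ ≠ y₁ := by
    rintro rfl
    exact hB _ h.fst.mem_Icc (h.fst.left ▸ h.fst.right)
  have hne' : x₂ ≠ y₂ := by
    rintro rfl
    exact hB _ h.snd.mem_Icc (h.snd.left ▸ h.snd.right)
  have l1 := h3.lt_of_ne hne
  have l2 := h4.lt_of_ne hne'
  exact hψ.ne x₁ x₂ (by linarith) (by linarith)
    (h.fst.left.trans ((congrArg a hτ₁₂).trans h.snd.left.symm))

/-- The three-discs proposition in the plane, with the first disc replaced by an arc. -/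
theorem IsPeriodicJordanCurve.exists_reversed_arc {ψ : ℝ → ℂ} (hψ : IsPeriodicJordanCurve ψ)
    {a : ℝ → ℂ} (ha : ContinuousOn a (Set.Icc 0 1)) (hinj : Set.InjOn a (Set.Icc 0 1))
    {B C : Set ℂ} (hB : IsClosed B) (hC : IsClosed C) [ContractibleSpace B] [ContractibleSpace C]
    (hAB : Disjoint (a '' Set.Icc 0 1) B) (hAC : Disjoint (a '' Set.Icc 0 1) C)
    (hBC : Disjoint B C) {x₁ y₁ x₂ y₂ : ℝ} (hxy₁ : x₁ ≤ y₁) (hyx₁ : y₁ ≤ x₂) (hxy₂ : x₂ ≤ y₂)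
    (hyx₂ : y₂ ≤ x₁ + 1) (hx₁ : ψ x₁ ∈ a '' Set.Icc 0 1) (hy₁ : ψ y₁ ∈ B)
    (hx₂ : ψ x₂ ∈ a '' Set.Icc 0 1) (hy₂ : ψ y₂ ∈ B) (hav₁ : ∀ t ∈ Set.Icc x₁ y₁, ψ t ∉ C)
    (hav₂ : ∀ t ∈ Set.Icc x₂ y₂, ψ t ∉ C) :
    ∃ c d, c < d ∧ d < c + 1 ∧ ψ c ∈ B ∧ ψ d ∈ a '' Set.Icc 0 1 ∧ ∀ t ∈ Set.Icc c d, ψ t ∉ C := by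
  by_contra! hBA
  wlog hac : Continuous a generalizing a
  · let a' : ℝ → ℂ := fun t ↦ a (max 0 (min 1 t))
    have haa : Set.EqOn a' a (Set.Icc 0 1) := fun t ht ↦ by simp [a', ht.1, ht.2]
    refine this (a := a') (ha.congr haa) (hinj.congr haa.symm) ?_ ?_ ?_ ?_ ?_ ?_
    any_goals rwa [haa.image_eq]
    exact ha.comp_continuous (by fun_prop) fun t ↦ by simp
  have hper := hψ.periodic
  have haB : ∀ τ ∈ Set.Icc (0 : ℝ) 1, a τ ∉ B := fun τ hτ ↦
    hAB.notMem_of_mem_left ⟨τ, hτ, rfl⟩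
  have haC : ∀ τ ∈ Set.Icc (0 : ℝ) 1, a τ ∉ C := fun τ hτ ↦
    hAC.notMem_of_mem_left ⟨τ, hτ, rfl⟩
  have hex : ∃ q, IsConnectionPair ψ a B C q := by
    obtain ⟨τ₁, hτ₁, h₁⟩ := hx₁
    obtain ⟨τ₂, hτ₂, h₂⟩ := hx₂
    refine ⟨((x₁, y₁, τ₁), (x₂, y₂, τ₂)), ⟨hxy₁, hτ₁, h₁.symm, hy₁, fun t ht ↦ ?_⟩,
      ⟨hxy₂, hτ₂, h₂.symm, hy₂, fun t ht ↦ ?_⟩, hyx₁, hyx₂⟩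
    · by_contra! h
      exact hav₁ t ⟨h.1.le, h.2.le⟩ ht
    · by_contra! h
      exact hav₂ t ⟨h.1.le, h.2.le⟩ ht
  obtain ⟨⟨⟨x₁, y₁, τ₁⟩, ⟨x₂, y₂, τ₂⟩⟩, hq, hmin⟩ :=
    IsConnectionPair.exists_min hψ.continuous hper hac hB hex
  have hr := hq.rotate hper
  have hsub : Set.uIcc τ₁ τ₂ ⊆ Set.Icc 0 1 := Set.uIcc_subset_Icc hq.fst.mem_Icc hq.snd.mem_Icc
  have : ContractibleSpace (Set.uIcc τ₁ τ₂) :=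
    (convex_uIcc τ₁ τ₂).contractibleSpace Set.nonempty_uIcc
  have : ContractibleSpace (a '' Set.uIcc τ₁ τ₂) :=
    isCompact_uIcc.contractibleSpace_image hac.continuousOn (hinj.mono hsub)
  have himg : a '' Set.uIcc τ₁ τ₂ ⊆ a '' Set.Icc 0 1 := Set.image_mono hsub
  have key : ∀ x y τ, IsConnection ψ a B C (x, y, τ) → x < y ∧ ∀ t ∈ Set.Icc x y, ψ t ∉ C := by
    intro x y τ h
    have hne : ∀ s t, ψ s = a τ → ψ t ∈ B → s ≠ t := by
      rintro s _ hs ht rfl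
      exact haB _ h.mem_Icc (hs ▸ ht)
    refine ⟨h.le.lt_of_ne (hne _ _ h.left h.right), fun t ht htC ↦ ?_⟩
    rcases h.avoids t htC with h' | h'
    · obtain rfl := le_antisymm h' ht.1
      exact haC _ h.mem_Icc (h.left ▸ htC)
    · obtain rfl := le_antisymm ht.2 h'
      exact hBC.notMem_of_mem_left h.right htC
  obtain ⟨hxy₁', hav₁'⟩ := key _ _ _ hq.fst
  obtain ⟨hxy₂', hav₂'⟩ := key _ _ _ hq.snd
  have hlt₁ : y₁ < x₂ := hq.le.lt_of_ne fun h ↦ by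
    simp only at h
    exact haB _ hq.snd.mem_Icc (hq.snd.left ▸ h ▸ hq.fst.right)
  have hlt₂ : y₂ < x₁ + 1 := hr.le.lt_of_ne fun h ↦ by
    simp only at h
    exact haB _ hr.snd.mem_Icc (hr.snd.left ▸ h ▸ hr.fst.right)
  have hS : SeparatedContinua (a '' Set.uIcc τ₁ τ₂) B C :=
    ⟨(isCompact_uIcc.image hac).isClosed, hB, hC, isPreconnected_uIcc.image _ hac.continuousOn,
      isPreconnected_iff_preconnectedSpace.2 inferInstance,
      isPreconnected_iff_preconnectedSpace.2 inferInstance,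
      hAB.mono_left himg, hAC.mono_left himg, hBC⟩
  obtain ⟨σ, hσ₁, hσ₂, hσ₃⟩ := exists_sqrt_sub hψ.continuous hper hψ.ne
  obtain ⟨κ, hκ⟩ := IsSqrtTriple.exists hS.disjoint₁₂ hS.disjoint₁₃ hS.disjoint₂₃
  refine false_of_two_parallel_arcs hψ hS ⟨hσ₁, hσ₂, hσ₃⟩ hκ hxy₁' hlt₁ hxy₂' hlt₂
    ⟨τ₁, Set.left_mem_uIcc, hq.fst.left.symm⟩ hq.fst.right
    ⟨τ₂, Set.right_mem_uIcc, hq.snd.left.symm⟩ hq.snd.right hav₁' hav₂' ?_ ?_ ?_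
  · exact fun s t hst hts hs ht ↦ hBA s t hst hts hs (himg ht)
  · exact fun s t h₁ h₁₂ h₂ hs ht ↦ hq.exists_mem_of_min hψ haB hmin h₁ h₁₂ h₂ hs ht
  · refine fun s t h₁ h₁₂ h₂ hs ht ↦ hr.exists_mem_of_min hψ haB (fun p hp ↦ ?_) h₁ h₁₂ h₂
      (by rwa [Set.uIcc_comm]) ht
    rw [abs_sub_comm]
    exact hmin p hp

/-- Stereographic projection from `p` onto the complex plane. -/
theorem exists_planar_chart (p : Sphere2) :
    ∃ e : OpenPartialHomeomorph Sphere2 ℂ, e.source = {p}ᶜ ∧ e.target = Set.univ := by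
  have : Fact (Module.finrank ℝ (EuclideanSpace ℝ (Fin 3)) = 2 + 1) := ⟨by simp⟩
  exact ⟨(stereographic' 2 p).transHomeomorph
    Complex.orthonormalBasisOneI.repr.symm.toHomeomorph, by simp, by simp⟩

theorem preconnectedSpace_sphere2 : PreconnectedSpace Sphere2 := by
  refine isPreconnected_iff_preconnectedSpace.1 (isPreconnected_sphere ?_ _ _)
  rw [rank_eq_card_basis (EuclideanSpace.basisFun (Fin 3) ℝ).toBasis]
  norm_num

/-- An open set contained in a Jordan curve is empty. -/
theorem eq_empty_of_isOpen_of_subset_range {ψ : C(AddCircle (1 : ℝ), Sphere2)}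
    (hψ : Function.Injective ψ) {U : Set Sphere2} (hU : IsOpen U) (hUψ : U ⊆ Set.range ψ) :
    U = ∅ := by
  by_contra! hne
  obtain ⟨u, hu⟩ := hne
  obtain ⟨p, hp⟩ : ∃ p : Sphere2, p ≠ u := ⟨-u, by
    intro h
    exact ne_neg_of_mem_unit_sphere ℝ u h.symm⟩
  obtain ⟨e, hes, het⟩ := exists_planar_chart p
  have hue : u ∈ e.source := by simp [hes, hp.symm]
  let V : Set ℂ := e.target ∩ e.symm ⁻¹' U
  have hV : IsOpen V := e.symm.isOpen_inter_preimage hU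
  have huV : e u ∈ V := ⟨e.map_source hue, by simpa [e.left_inv hue] using hu⟩
  let g : Sphere2 → AddCircle (1 : ℝ) := Function.invFun ψ
  have hg : ∀ x ∈ Set.range ψ, ψ (g x) = x := fun x hx ↦ Function.invFun_eq hx
  have hgc : ContinuousOn g (Set.range ψ) := by
    have hemb := (ψ.continuous.isClosedEmbedding hψ).isInducing
    exact hemb.continuousOn_iff.2 (continuousOn_id.congr hg)
  have hVψ : Set.MapsTo e.symm V (Set.range ψ) := fun z hz ↦ hUψ hz.2
  let f : ℂ → ℂ := fun z ↦ (AddCircle.toCircle (g (e.symm z)) : ℂ)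
  have hf : ContinuousOn f V :=
    (continuous_subtype_val.comp AddCircle.continuous_toCircle).comp_continuousOn
      (hgc.comp (e.continuousOn_symm.mono Set.inter_subset_left) hVψ)
  have hfi : Set.InjOn f V := by
    intro z hz w hw h
    have h1 := AddCircle.injective_toCircle one_ne_zero (Circle.ext h)
    have h2 : e.symm z = e.symm w := by
      rw [← hg _ (hVψ hz), ← hg _ (hVψ hw), h1]
    exact e.symm.injOn hz.1 hw.1 h2
  have hopen := isOpen_image_of_injOn hV hf hfi
  have hsub : f '' V ⊆ interior (Metric.sphere (0 : ℂ) 1) := by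
    refine interior_maximal ?_ hopen
    rintro _ ⟨z, -, rfl⟩
    exact (AddCircle.toCircle _).2
  rw [interior_sphere _ one_ne_zero] at hsub
  exact hsub ⟨_, huV, rfl⟩

theorem IsTopologicalClosedDisc.isClosed {D : Set Sphere2} (hD : IsTopologicalClosedDisc D) :
    IsClosed D := by
  obtain ⟨h⟩ := hD
  have := isCompact_iff_compactSpace.1
    (isCompact_closedBall (0 : EuclideanSpace ℝ (Fin 2)) 1)
  exact (isCompact_iff_compactSpace.2 h.symm.compactSpace).isClosed

theorem IsTopologicalClosedDisc.nonempty {D : Set Sphere2} (hD : IsTopologicalClosedDisc D) :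
    D.Nonempty := by
  obtain ⟨h⟩ := hD
  exact ⟨_, (h.symm ⟨0, by simp⟩).2⟩

theorem exists_notMem_discs {D₁ D₂ D₃ : Set Sphere2} (hD₁ : IsTopologicalClosedDisc D₁)
    (hD₂ : IsTopologicalClosedDisc D₂) (hD₃ : IsTopologicalClosedDisc D₃) (h₁₂ : Disjoint D₁ D₂)
    (h₁₃ : Disjoint D₁ D₃) {ψ : C(AddCircle (1 : ℝ), Sphere2)} (hψ : Function.Injective ψ) :
    ∃ p, p ∉ D₁ ∧ p ∉ D₂ ∧ p ∉ D₃ ∧ p ∉ Set.range ψ := by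
  by_contra! h
  have hempty := eq_empty_of_isOpen_of_subset_range hψ (U := (D₁ ∪ (D₂ ∪ D₃))ᶜ)
    (hD₁.isClosed.union (hD₂.isClosed.union hD₃.isClosed)).isOpen_compl (by
      intro x hx
      simp only [Set.mem_compl_iff, Set.mem_union, not_or] at hx
      exact h x hx.1 hx.2.1 hx.2.2)
  have hcompl : D₁ᶜ = D₂ ∪ D₃ := by
    refine Set.Subset.antisymm (fun x hx ↦ ?_) ?_
    · exact (Set.compl_empty_iff.1 hempty ▸ Set.mem_univ x : x ∈ D₁ ∪ (D₂ ∪ D₃)).resolve_left hx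
    · exact Set.union_subset h₁₂.subset_compl_left h₁₃.subset_compl_left
  have hclopen : IsClopen D₁ :=
    ⟨hD₁.isClosed, by
      rw [← isClosed_compl_iff, hcompl]
      exact hD₂.isClosed.union hD₃.isClosed⟩
  have := preconnectedSpace_sphere2
  rcases isClopen_iff.1 hclopen with h' | h'
  · exact hD₁.nonempty.ne_empty h'
  · obtain ⟨x, hx⟩ := hD₂.nonempty
    exact h₁₂.notMem_of_mem_right hx (h' ▸ Set.mem_univ x)

theorem IsTopologicalClosedDisc.exists_homeomorph_image {D : Set Sphere2}
    (hD : IsTopologicalClosedDisc D) (e : OpenPartialHomeomorph Sphere2 ℂ) (hDe : D ⊆ e.source) :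
    Nonempty (Metric.closedBall (0 : ℂ) 1 ≃ₜ e '' D) := by
  obtain ⟨h⟩ := hD
  let i : Metric.closedBall (0 : ℂ) 1 ≃ₜ Metric.closedBall (0 : EuclideanSpace ℝ (Fin 2)) 1 :=
    Complex.orthonormalBasisOneI.repr.toHomeomorph.subtype fun z ↦ by simp
  exact ⟨i.trans (h.symm.trans (e.homeomorphOfImageSubsetSource hDe rfl))⟩

theorem contractibleSpace_of_homeomorph_closedBall {E : Set ℂ}
    (h : Metric.closedBall (0 : ℂ) 1 ≃ₜ E) : ContractibleSpace E := by
  have := (convex_closedBall (0 : ℂ) 1).contractibleSpace ⟨0, by simp⟩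
  exact h.symm.contractibleSpace

/-- Two interior points of a plane disc are joined by an arc in its interior. -/
theorem exists_arc_in_interior {E : Set ℂ} (h : Metric.closedBall (0 : ℂ) 1 ≃ₜ E) {x y : ℂ}
    (hx : x ∈ interior E) (hy : y ∈ interior E) (hxy : x ≠ y) :
    ∃ a : ℝ → ℂ, ContinuousOn a (Set.Icc 0 1) ∧ Set.InjOn a (Set.Icc 0 1) ∧
      a '' Set.Icc 0 1 ⊆ interior E ∧ x ∈ a '' Set.Icc 0 1 ∧ y ∈ a '' Set.Icc 0 1 := by
  classical
  let f : ℂ → ℂ := fun z ↦ if hz : z ∈ Metric.closedBall 0 1 then h ⟨z, hz⟩ else 0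
  let g : ℂ → ℂ := fun w ↦ if hw : w ∈ E then h.symm ⟨w, hw⟩ else 0
  have hf : ContinuousOn f (Metric.closedBall 0 1) := by
    rw [continuousOn_iff_continuous_domRestrict]
    convert continuous_subtype_val.comp h.continuous using 1
    ext z
    exact dif_pos z.2
  have hg : ContinuousOn g E := by
    rw [continuousOn_iff_continuous_domRestrict]
    convert continuous_subtype_val.comp h.symm.continuous using 1
    ext z
    simp [g]
  have hfE : ∀ z ∈ Metric.closedBall (0 : ℂ) 1, f z ∈ E := fun z hz ↦ by
    simp only [f, dif_pos hz]
    exact (h ⟨z, hz⟩).2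
  have hgE : ∀ w ∈ E, g w ∈ Metric.closedBall (0 : ℂ) 1 := fun w hw ↦ by
    simp only [g, dif_pos hw]
    exact (h.symm ⟨w, hw⟩).2
  have hgf : ∀ z ∈ Metric.closedBall (0 : ℂ) 1, g (f z) = z := fun z hz ↦ by
    have := hfE z hz
    simp only [f, dif_pos hz] at this
    simp only [f, g, dif_pos hz, dif_pos this, Subtype.coe_eta, Homeomorph.symm_apply_apply]
  have hfg : ∀ w ∈ E, f (g w) = w := fun w hw ↦ by
    have := hgE w hw
    simp only [g, dif_pos hw] at this
    simp only [f, g, dif_pos hw, dif_pos this, Subtype.coe_eta, Homeomorph.apply_symm_apply]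
  have hfi : Set.InjOn f (Metric.closedBall 0 1) := Set.LeftInvOn.injOn hgf
  have hgi : Set.InjOn g E := Set.LeftInvOn.injOn hfg
  have hball : f '' Metric.ball 0 1 ⊆ interior E := by
    refine interior_maximal ?_ (isOpen_image_of_injOn Metric.isOpen_ball
      (hf.mono Metric.ball_subset_closedBall) (hfi.mono Metric.ball_subset_closedBall))
    rintro _ ⟨z, hz, rfl⟩
    exact hfE z (Metric.ball_subset_closedBall hz)
  have hint : g '' interior E ⊆ Metric.ball 0 1 := by
    rw [← interior_closedBall (0 : ℂ) one_ne_zero]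
    refine interior_maximal ?_ (isOpen_image_of_injOn isOpen_interior
      (hg.mono interior_subset) (hgi.mono interior_subset))
    rintro _ ⟨z, hz, rfl⟩
    exact hgE z (interior_subset hz)
  have hl : Set.MapsTo (AffineMap.lineMap (k := ℝ) (g x) (g y)) (Set.Icc (0 : ℝ) 1)
      (Metric.ball 0 1) := fun t ht ↦
    (convex_ball (0 : ℂ) 1).lineMap_mem (hint ⟨x, hx, rfl⟩) (hint ⟨y, hy, rfl⟩) ht
  have hgxy : g x ≠ g y := fun h ↦ hxy (hgi (interior_subset hx) (interior_subset hy) h)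
  refine ⟨fun t ↦ f (AffineMap.lineMap (g x) (g y) t), ?_, ?_, ?_, ⟨0, by simp, ?_⟩,
    ⟨1, by simp, ?_⟩⟩
  · exact (hf.mono Metric.ball_subset_closedBall).comp (by fun_prop) hl
  · exact (hfi.mono Metric.ball_subset_closedBall).comp
      (AffineMap.lineMap_injective ℝ hgxy).injOn hl
  · rintro _ ⟨t, ht, rfl⟩
    exact hball ⟨_, hl ht, rfl⟩
  · simp [hfg x (interior_subset hx)]
  · simp [hfg y (interior_subset hy)]

theorem OpenPartialHomeomorph.mem_interior_image_iff {X Y : Type*} [TopologicalSpace X]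
    [TopologicalSpace Y] (e : OpenPartialHomeomorph X Y) {D : Set X} (hD : D ⊆ e.source) {x : X}
    (hx : x ∈ e.source) : e x ∈ interior (e '' D) ↔ x ∈ interior D := by
  have hsub : e '' D ⊆ e.target := Set.image_subset_iff.2 fun z hz ↦ e.map_source (hD hz)
  refine ⟨fun h ↦ ?_, fun h ↦ ?_⟩
  · refine interior_maximal (s := D) (t := e.symm '' interior (e '' D)) ?_
      (e.isOpen_image_symm_of_subset_target isOpen_interior (interior_subset.trans hsub))
      ⟨e x, h, e.left_inv hx⟩
    rintro _ ⟨w, hw, rfl⟩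
    obtain ⟨z, hz, rfl⟩ := interior_subset hw
    rwa [e.left_inv (hD hz)]
  · exact interior_maximal (Set.image_mono interior_subset)
      (e.isOpen_image_of_subset_source isOpen_interior (interior_subset.trans hD)) ⟨x, h, rfl⟩

theorem OpenPartialHomeomorph.isPeriodicJordanCurve (e : OpenPartialHomeomorph Sphere2 ℂ)
    {ψ : C(AddCircle (1 : ℝ), Sphere2)} (hψ : Function.Injective ψ)
    (hψe : ∀ θ, ψ θ ∈ e.source) : IsPeriodicJordanCurve fun t : ℝ ↦ e (ψ t) := by
  refine ⟨e.continuousOn.comp_continuous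
    (ψ.continuous.comp (AddCircle.continuous_mk' 1)) fun t ↦ hψe t, fun t ↦ ?_,
    fun s t hst hts h ↦ ?_⟩
  · simp
  · have h1 := hψ (e.injOn (hψe _) (hψe _) h)
    have : Fact ((0 : ℝ) < 1) := ⟨one_pos⟩
    exact hst.ne ((AddCircle.coe_eq_coe_iff_of_mem_Ico (p := (1 : ℝ)) (a := s)
      ⟨le_rfl, by linarith⟩ ⟨hst.le, hts⟩).1 h1)

/-- Three-discs proposition: if a Jordan curve `ψ : S¹ → S²` contains two disjoint
positively oriented arcs beginning in the interior of `D₁`, ending in the interior of `D₂`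
and avoiding `D₃`, then it contains a positively oriented arc beginning in the interior of
`D₂`, ending in the interior of `D₁` and avoiding `D₃`. -/
theorem three_discs_reversed_arc
    (D₁ D₂ D₃ : Set Sphere2)
    (hD₁ : IsTopologicalClosedDisc D₁) (hD₂ : IsTopologicalClosedDisc D₂)
    (hD₃ : IsTopologicalClosedDisc D₃)
    (h₁₂ : Disjoint D₁ D₂) (h₁₃ : Disjoint D₁ D₃) (h₂₃ : Disjoint D₂ D₃)
    (ψ : C(AddCircle (1 : ℝ), Sphere2)) (hψ : Function.Injective ψ)
    (a₁ a₂ : AddCircle (1 : ℝ)) (ℓ₁ ℓ₂ : ℝ)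
    (hℓ₁ : 0 < ℓ₁) (hℓ₁' : ℓ₁ < 1) (hℓ₂ : 0 < ℓ₂) (hℓ₂' : ℓ₂ < 1)
    (harcs : Disjoint (circleArc a₁ ℓ₁) (circleArc a₂ ℓ₂))
    (ha₁ : ψ a₁ ∈ interior D₁) (hb₁ : ψ (a₁ + (ℓ₁ : AddCircle (1 : ℝ))) ∈ interior D₂)
    (ha₂ : ψ a₂ ∈ interior D₁) (hb₂ : ψ (a₂ + (ℓ₂ : AddCircle (1 : ℝ))) ∈ interior D₂)
    (hav₁ : ψ '' circleArc a₁ ℓ₁ ∩ D₃ = ∅)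
    (hav₂ : ψ '' circleArc a₂ ℓ₂ ∩ D₃ = ∅) :
    ∃ (c : AddCircle (1 : ℝ)) (ℓ : ℝ), 0 < ℓ ∧ ℓ < 1 ∧
      ψ c ∈ interior D₂ ∧ ψ (c + (ℓ : AddCircle (1 : ℝ))) ∈ interior D₁ ∧
      ψ '' circleArc c ℓ ∩ D₃ = ∅ := by
  obtain ⟨p, hp₁, hp₂, hp₃, hpψ⟩ := exists_notMem_discs hD₁ hD₂ hD₃ h₁₂ h₁₃ hψ
  obtain ⟨e, hes, -⟩ := exists_planar_chart p
  have hsub : ∀ D : Set Sphere2, p ∉ D → D ⊆ e.source := fun D hD x hx ↦ by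
    rw [hes]
    exact fun h ↦ hD (h ▸ hx)
  have hψe : ∀ θ, ψ θ ∈ e.source := fun θ ↦ hsub _ hpψ ⟨θ, rfl⟩
  have hJ := e.isPeriodicJordanCurve hψ hψe
  have hint : ∀ D, p ∉ D → ∀ θ, e (ψ θ) ∈ interior (e '' D) ↔ ψ θ ∈ interior D :=
    fun D hD θ ↦ e.mem_interior_image_iff (hsub D hD) (hψe θ)
  have hdisj : ∀ D D', p ∉ D → p ∉ D' → Disjoint D D' → Disjoint (e '' D) (e '' D') :=
    fun D D' hD hD' h ↦ h.image e.injOn (hsub D hD) (hsub D' hD')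
  obtain ⟨H₁⟩ := hD₁.exists_homeomorph_image e (hsub _ hp₁)
  obtain ⟨H₂⟩ := hD₂.exists_homeomorph_image e (hsub _ hp₂)
  obtain ⟨H₃⟩ := hD₃.exists_homeomorph_image e (hsub _ hp₃)
  obtain ⟨x₁, rfl⟩ := QuotientAddGroup.mk_surjective a₁
  obtain ⟨x₂, ⟨hx₁₂, hx₂₁⟩, rfl⟩ :
      ∃ x₂ : ℝ, (x₁ ≤ x₂ ∧ x₂ < x₁ + 1) ∧ (x₂ : AddCircle (1 : ℝ)) = a₂ := by
    have : Fact ((0 : ℝ) < 1) := ⟨one_pos⟩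
    have h := AddCircle.coe_image_Ico_eq (1 : ℝ) x₁
    obtain ⟨x, hx, hxa⟩ := h ▸ Set.mem_univ a₂
    exact ⟨x, hx, hxa⟩
  change ψ (x₁ : AddCircle (1 : ℝ)) ∈ _ at ha₁
  change ψ ((x₁ : AddCircle (1 : ℝ)) + _) ∈ _ at hb₁
  change Disjoint (circleArc (x₁ : AddCircle (1 : ℝ)) ℓ₁) _ at harcs
  change ψ '' circleArc (x₁ : AddCircle (1 : ℝ)) ℓ₁ ∩ D₃ = ∅ at hav₁
  have hmem : ∀ (x ℓ t : ℝ), x ≤ t → t ≤ x + ℓ →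
      (t : AddCircle (1 : ℝ)) ∈ circleArc (x : AddCircle (1 : ℝ)) ℓ := fun x ℓ t h h' ↦
    ⟨t - x, ⟨by linarith, by linarith⟩, by simp only [← AddCircle.coe_add, add_sub_cancel]⟩
  have hyx₁ : x₁ + ℓ₁ < x₂ := by
    by_contra! h
    exact harcs.notMem_of_mem_left (hmem x₁ ℓ₁ x₂ hx₁₂ h) (hmem x₂ ℓ₂ x₂ le_rfl (by linarith))
  have hyx₂ : x₂ + ℓ₂ < x₁ + 1 := by
    by_contra! h
    have h1 := hmem x₂ ℓ₂ (x₁ + 1) hx₂₁.le h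
    rw [AddCircle.coe_add_period] at h1
    exact harcs.notMem_of_mem_left (hmem x₁ ℓ₁ x₁ le_rfl (by linarith)) h1
  rw [← AddCircle.coe_add] at hb₁ hb₂
  have hne : ∀ s t : ℝ, s < t → t < s + 1 → e (ψ s) ≠ e (ψ t) := hJ.ne
  obtain ⟨a, ha, hai, haD, hax₁, hax₂⟩ := exists_arc_in_interior H₁ ((hint _ hp₁ _).2 ha₁)
    ((hint _ hp₁ _).2 ha₂) (hne _ _ (by linarith) (by linarith))
  obtain ⟨b, hb, hbi, hbD, hby₁, hby₂⟩ := exists_arc_in_interior H₂ ((hint _ hp₂ _).2 hb₁)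
    ((hint _ hp₂ _).2 hb₂) (hne _ _ (by linarith) (by linarith))
  have hcb : ContractibleSpace (b '' Set.Icc 0 1) := by
    have := (convex_Icc (0 : ℝ) 1).contractibleSpace ⟨0, by simp⟩
    exact isCompact_Icc.contractibleSpace_image hb hbi
  have hcC := contractibleSpace_of_homeomorph_closedBall H₃
  have hC : IsClosed (e '' D₃) :=
    (hD₃.isClosed.isCompact.image_of_continuousOn (e.continuousOn.mono (hsub _ hp₃))).isClosed
  have hA := haD.trans interior_subset
  have hB := hbD.trans interior_subset
  have hav : ∀ (x ℓ : ℝ), ψ '' circleArc (x : AddCircle (1 : ℝ)) ℓ ∩ D₃ = ∅ →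
      ∀ t ∈ Set.Icc x (x + ℓ), e (ψ t) ∉ e '' D₃ := by
    rintro x ℓ h t ht ⟨z, hz, hzt⟩
    obtain rfl := e.injOn (hsub _ hp₃ hz) (hψe _) hzt
    exact Set.eq_empty_iff_forall_notMem.1 h _ ⟨⟨_, hmem x ℓ t ht.1 ht.2, rfl⟩, hz⟩
  obtain ⟨c, d, hcd, hdc, hc, hd, hcdC⟩ := hJ.exists_reversed_arc ha hai
    (isCompact_Icc.image_of_continuousOn hb).isClosed hC
    ((hdisj _ _ hp₁ hp₂ h₁₂).mono hA hB) ((hdisj _ _ hp₁ hp₃ h₁₃).mono_left hA)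
    ((hdisj _ _ hp₂ hp₃ h₂₃).mono_left hB) (by linarith) hyx₁.le (by linarith) hyx₂.le
    hax₁ hby₁ hax₂ hby₂ (hav _ _ hav₁) (hav _ _ hav₂)
  refine ⟨c, d - c, by linarith, by linarith, (hint _ hp₂ _).1 (hbD hc), ?_, ?_⟩
  · rw [← AddCircle.coe_add, add_sub_cancel]
    exact (hint _ hp₁ _).1 (haD hd)
  · rw [Set.eq_empty_iff_forall_notMem]
    rintro _ ⟨⟨_, ⟨s, hs, rfl⟩, rfl⟩, hz⟩
    refine hcdC (c + s) ⟨by linarith [hs.1], by linarith [hs.2]⟩ ⟨_, hz, ?_⟩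
    simp only [AddCircle.coe_add]
end

section
/- If ψ : S¹ → ℝ² is a Jordan curve, then for every δ > 0 there exists a polygonal Jordan curve ψ̂ : S¹ → ℝ² such that sup over t ∈ S¹ of ‖ψ(t) − ψ̂(t)‖ is less than δ. -/
open scoped NNReal
open Filter Topology

/-- A closed curve `f : ℝ/ℤ → ℝ²` is polygonal (piecewise affine) if there are parameters
`0 = s₀ < s₁ < ⋯ < s_k = 1` and points `p₀, …, p_k = p₀` such that on each interval
`[s_{j}, s_{j+1}]` the curve is the affine segment from `p_j` to `p_{j+1}`. -/
def IsPolygonalClosedCurve (f : AddCircle (1 : ℝ) → EuclideanSpace ℝ (Fin 2)) : Prop :=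
  ∃ (k : ℕ) (s : ℕ → ℝ) (p : ℕ → EuclideanSpace ℝ (Fin 2)),
    0 < k ∧ s 0 = 0 ∧ s k = 1 ∧ (∀ j < k, s j < s (j + 1)) ∧ p k = p 0 ∧
    ∀ j < k, ∀ x ∈ Set.Icc (s j) (s (j + 1)),
      f (x : AddCircle (1 : ℝ)) = p j + ((x - s j) / (s (j + 1) - s j)) • (p (j + 1) - p j)

/-- A map on the line is affine near `x`. -/
def LocallyAffineAt {V : Type*} [AddCommGroup V] [Module ℝ V] (f : ℝ → V) (x : ℝ) : Prop :=
  ∃ u v : V, ∀ᶠ y in 𝓝 x, f y = u + y • v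

/-- A map on the circle is affine near `t` in the coordinate given by the covering line. -/
def CircleAffineAt {V : Type*} [AddCommGroup V] [Module ℝ V]
    (f : AddCircle (1 : ℝ) → V) (t : AddCircle (1 : ℝ)) : Prop :=
  ∀ x : ℝ, (x : AddCircle (1 : ℝ)) = t → LocallyAffineAt (fun y : ℝ => f y) x

section Circle

variable {V : Type*} [NormedAddCommGroup V]

lemma coe_circle_eq_coe_iff (x y : ℝ) :
    (x : AddCircle (1 : ℝ)) = y ↔ ∃ n : ℤ, x = y + n := by
  rw [← sub_eq_zero, ← AddCircle.coe_sub, AddCircle.coe_eq_zero_iff]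
  constructor
  · rintro ⟨n, hn⟩
    exact ⟨n, by simp at hn; linarith⟩
  · rintro ⟨n, hn⟩
    exact ⟨n, by simp; linarith⟩

lemma coe_circle_sub_intCast (x : ℝ) (n : ℤ) :
    ((x - n : ℝ) : AddCircle (1 : ℝ)) = x :=
  (coe_circle_eq_coe_iff _ _).2 ⟨-n, by push_cast; ring⟩

lemma dist_coe_circle (x y : ℝ) :
    dist (x : AddCircle (1 : ℝ)) y = |x - y - round (x - y)| := by
  rw [dist_eq_norm, ← AddCircle.coe_sub, AddCircle.norm_eq]
  simp

lemma dist_coe_circle_le (x y : ℝ) : dist (x : AddCircle (1 : ℝ)) y ≤ |x - y| := by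
  rw [dist_coe_circle]
  simpa using round_le (x - y) 0

lemma dist_coe_circle_of_abs_le {x y : ℝ} (h : |x - y| ≤ 1 / 2) :
    dist (x : AddCircle (1 : ℝ)) y = |x - y| := by
  rw [dist_eq_norm, ← AddCircle.coe_sub]
  exact (AddCircle.norm_coe_eq_abs_iff 1 one_ne_zero).2 (by simpa using h)

/-- The preimage of a closed set under a map of the circle, if it is small, is contained in a small
arc whose two ends are mapped into the set. -/
lemma exists_minimal_arc {f : AddCircle (1 : ℝ) → V} (hf : Continuous f)
    {S : Set V} (hS : IsClosed S) {η : ℝ} (hη : η ≤ 1 / 4)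
    (hfS : ∀ s t, f s ∈ S → f t ∈ S → dist s t < η) {t₀ : AddCircle (1 : ℝ)} (ht₀ : f t₀ ∈ S) :
    ∃ a b c : ℝ, a ≤ c ∧ c ≤ b ∧ b < a + 1 ∧ f a ∈ S ∧ f b ∈ S ∧ f c ∈ S ∧
      c - a < η ∧ b - c < η ∧ ∀ x ∈ Set.Ioo b (a + 1), f (x : AddCircle (1 : ℝ)) ∉ S := by
  obtain ⟨c, -, rfl⟩ := AddCircle.eq_coe_Ico t₀
  have hcont : Continuous (fun x : ℝ => f x) := hf.comp QuotientAddGroup.continuous_mk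
  have hK : IsCompact (Set.Icc (c - 1 / 4) (c + 1 / 4) ∩ (fun x : ℝ => f x) ⁻¹' S) :=
    isCompact_Icc.inter_right (hS.preimage hcont)
  have hcK : c ∈ Set.Icc (c - 1 / 4) (c + 1 / 4) ∩ (fun x : ℝ => f x) ⁻¹' S :=
    ⟨⟨by linarith, by linarith⟩, ht₀⟩
  obtain ⟨a, ⟨⟨ha₁, ha₂⟩, haS⟩, hale⟩ := hK.exists_isLeast ⟨c, hcK⟩
  obtain ⟨b, ⟨⟨hb₁, hb₂⟩, hbS⟩, hble⟩ := hK.exists_isGreatest ⟨c, hcK⟩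
  have hac : a ≤ c := hale hcK
  have hcb : c ≤ b := hble hcK
  refine ⟨a, b, c, hac, hcb, by linarith, haS, hbS, ht₀, ?_, ?_, ?_⟩
  · have h := hfS _ _ ht₀ haS
    rw [dist_coe_circle_of_abs_le (abs_le.2 ⟨by linarith, by linarith⟩)] at h
    exact (le_abs_self _).trans_lt h
  · have h := hfS _ _ hbS ht₀
    rw [dist_coe_circle_of_abs_le (abs_le.2 ⟨by linarith, by linarith⟩)] at h
    exact (le_abs_self _).trans_lt h
  · rintro x ⟨hbx, hxa⟩ hx
    have h := hfS _ _ hx ht₀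
    rw [dist_coe_circle] at h
    obtain ⟨h₁, h₂⟩ := abs_lt.1 h
    set n := round (x - c)
    have hn : x - n ∈ Set.Icc (c - 1 / 4) (c + 1 / 4) ∩ (fun x : ℝ => f x) ⁻¹' S := by
      refine ⟨⟨by linarith, by linarith⟩, ?_⟩
      simpa only [Set.mem_preimage, coe_circle_sub_intCast] using hx
    have h₃ : a ≤ x - n := hale hn
    have h₄ : x - n ≤ b := hble hn
    have h₅ : (n : ℝ) < 1 := by linarith
    have h₆ : (0 : ℝ) < n := by linarith
    norm_cast at h₅ h₆
    omega

lemma exists_dist_lt_of_dist_image_lt {ψ : C(AddCircle (1 : ℝ), V)} (hψ : Function.Injective ψ)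
    {η : ℝ} (hη : 0 < η) : ∃ ε > 0, ∀ s t, dist (ψ s) (ψ t) < ε → dist s t < η := by
  set K : Set (AddCircle (1 : ℝ) × AddCircle (1 : ℝ)) := {q | η ≤ dist q.1 q.2}
  have hK : IsCompact K := (isClosed_le continuous_const continuous_dist).isCompact
  have hcont : ContinuousOn (fun q : AddCircle (1 : ℝ) × AddCircle (1 : ℝ) =>
      dist (ψ q.1) (ψ q.2)) K := by fun_prop
  rcases K.eq_empty_or_nonempty with hne | hne
  · exact ⟨1, one_pos, fun s t _ => not_le.1 fun hst => hne.subset (show (s, t) ∈ K from hst)⟩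
  · obtain ⟨q, hq, hmin⟩ := hK.exists_isMinOn hne hcont
    refine ⟨dist (ψ q.1) (ψ q.2), dist_pos.2 fun h => ?_, fun s t hst => not_le.1 fun hle => ?_⟩
    · have hq' : η ≤ dist q.1 q.2 := hq
      rw [hψ h, dist_self] at hq'
      linarith
    · exact hst.not_ge (hmin (show (s, t) ∈ K from hle))

variable [NormedSpace ℝ V]

lemma circleAffineAt_coe {f : AddCircle (1 : ℝ) → V} {x : ℝ}
    (h : LocallyAffineAt (fun y : ℝ => f y) x) : CircleAffineAt f (x : AddCircle (1 : ℝ)) := by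
  intro z hz
  obtain ⟨n, rfl⟩ := (coe_circle_eq_coe_iff _ _).1 hz
  obtain ⟨u, v, h⟩ := h
  refine ⟨u - (n : ℝ) • v, v, ?_⟩
  have hc : Tendsto (fun y : ℝ => y - n) (𝓝 (x + n)) (𝓝 x) := by
    have : ContinuousAt (fun y : ℝ => y - n) (x + n) := by fun_prop
    simpa [ContinuousAt] using this
  filter_upwards [hc.eventually h] with y hy
  rw [coe_circle_sub_intCast] at hy
  rw [hy]
  module

lemma CircleAffineAt.congr {f g : AddCircle (1 : ℝ) → V} {t : AddCircle (1 : ℝ)}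
    (hf : CircleAffineAt f t) (h : g =ᶠ[𝓝 t] f) : CircleAffineAt g t := by
  intro x hx
  obtain ⟨u, v, huv⟩ := hf x hx
  refine ⟨u, v, ?_⟩
  have hc : Tendsto (fun y : ℝ => (y : AddCircle (1 : ℝ))) (𝓝 x) (𝓝 t) := by
    rw [← hx]
    exact QuotientAddGroup.continuous_mk.tendsto x
  filter_upwards [hc.eventually h, huv] with y h₁ h₂
  rw [h₁, h₂]

/-- Replacing the smallest arc of a Jordan curve which contains the preimage of a convex set by a
segment. -/
lemma exists_straightening {f : C(AddCircle (1 : ℝ), V)} (hf : Function.Injective f)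
    {S : Set V} (hS : IsClosed S) (hconv : Convex ℝ S) {η : ℝ} (hη : η ≤ 1 / 4)
    (hfS : ∀ s t, f s ∈ S → f t ∈ S → dist s t < η) :
    ∃ g : C(AddCircle (1 : ℝ), V), Function.Injective g ∧
      (∃ F : Set (AddCircle (1 : ℝ)), F.Finite ∧
        ∀ t ∉ F, CircleAffineAt g t ∨ (f t ∉ S ∧ g =ᶠ[𝓝 t] f)) ∧
      ∀ t, g t = f t ∨ (g t ∈ S ∧ ∃ s, f s ∈ S ∧ dist s t < η) := by
  by_cases hne : ∃ t₀, f t₀ ∈ S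
  swap
  · push Not at hne
    exact ⟨f, hf, ⟨∅, Set.finite_empty, fun t _ => .inr ⟨hne t, .rfl⟩⟩, fun t => .inl rfl⟩
  obtain ⟨t₀, ht₀⟩ := hne
  obtain ⟨a, b, c, hac, hcb, hba, haS, hbS, hcS, hca, hbc, hout⟩ :=
    exists_minimal_arc f.continuous hS hη hfS ht₀
  set φ : ℝ → V := fun x =>
    if x ≤ b then AffineMap.lineMap (f a) (f b) ((x - a) / (b - a)) else f x
  have hφ_le : ∀ {x}, x ≤ b → φ x = AffineMap.lineMap (f a) (f b) ((x - a) / (b - a)) :=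
    fun h => if_pos h
  have hφ_gt : ∀ {x}, b < x → φ x = f x := fun h => if_neg h.not_ge
  have hφ_cont : Continuous φ := by
    refine Continuous.if_le ?_ (f.continuous.comp QuotientAddGroup.continuous_mk)
      continuous_id continuous_const ?_
    · exact AffineMap.lineMap_continuous.comp (by fun_prop)
    · rintro x rfl
      rcases eq_or_lt_of_le (hac.trans hcb) with h | h
      · simp [h]
      · rw [div_self (by linarith)]
        simp
  have hφ_per : φ a = φ (a + 1) := by
    rw [hφ_le (hac.trans hcb), hφ_gt hba]
    simp
  set g : C(AddCircle (1 : ℝ), V) :=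
    ⟨AddCircle.liftIco 1 a φ, AddCircle.liftIco_continuous hφ_per hφ_cont.continuousOn⟩
  have hgφ : ∀ {x : ℝ}, x ∈ Set.Ico a (a + 1) → g x = φ x :=
    fun h => AddCircle.liftIco_coe_apply (p := (1 : ℝ)) (f := φ) h
  have hrep : ∀ t : AddCircle (1 : ℝ), ∃ x ∈ Set.Ico a (a + 1), (x : AddCircle (1 : ℝ)) = t := by
    intro t
    have ht : t ∈ QuotientAddGroup.mk '' Set.Ico a (a + 1) := by
      rw [AddCircle.coe_image_Ico_eq 1 a]
      trivial
    exact ht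
  have hφS : ∀ {x}, a ≤ x → x ≤ b → φ x ∈ S := by
    intro x hax hxb
    rw [hφ_le hxb]
    exact hconv.lineMap_mem haS hbS
      ⟨div_nonneg (by linarith) (by linarith), div_le_one_of_le₀ (by linarith) (by linarith)⟩
  refine ⟨g, ?_, ⟨{(a : AddCircle (1 : ℝ)), (b : AddCircle (1 : ℝ))}, by simp, ?_⟩, ?_⟩
  · intro s t hst
    obtain ⟨x, hx, rfl⟩ := hrep s
    obtain ⟨y, hy, rfl⟩ := hrep t
    rw [hgφ hx, hgφ hy] at hst
    rcases le_or_gt x b with hxb | hxb <;> rcases le_or_gt y b with hyb | hyb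
    · rcases eq_or_lt_of_le (hac.trans hcb) with h | h
      · have h₁ : x = y := by linarith [hx.1, hy.1]
        rw [h₁]
      · have hab : f a ≠ f b := by
          intro hab
          have := (AddCircle.coe_eq_coe_iff_of_mem_Ico (a := a) (p := (1 : ℝ))
            ⟨le_rfl, by linarith⟩ ⟨h.le, hba⟩).1 (hf hab)
          linarith
        rw [hφ_le hxb, hφ_le hyb] at hst
        have h₁ := AffineMap.lineMap_injective ℝ hab hst
        have h₂ : b - a ≠ 0 := by linarith
        field_simp at h₁
        have h₃ : x = y := by linarith
        rw [h₃]
    · exact absurd (hst ▸ hφS hx.1 hxb) (by rw [hφ_gt hyb]; exact hout y ⟨hyb, hy.2⟩)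
    · exact absurd (hst.symm ▸ hφS hy.1 hyb) (by rw [hφ_gt hxb]; exact hout x ⟨hxb, hx.2⟩)
    · rw [hφ_gt hxb, hφ_gt hyb] at hst
      exact hf hst
  · intro t ht
    obtain ⟨x, hx, rfl⟩ := hrep t
    have hxa : x ≠ a := by
      rintro rfl
      simp at ht
    have hxb : x ≠ b := by
      rintro rfl
      simp at ht
    have hax : a < x := lt_of_le_of_ne hx.1 hxa.symm
    rcases lt_or_gt_of_ne hxb with h | h
    · left
      refine circleAffineAt_coe ⟨f a - (a / (b - a)) • (f b - f a), (b - a)⁻¹ • (f b - f a), ?_⟩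
      filter_upwards [Ioo_mem_nhds hax h] with y hy
      rw [hgφ ⟨hy.1.le, hy.2.trans hba⟩, hφ_le hy.2.le, AffineMap.lineMap_apply_module']
      module
    · right
      refine ⟨hout x ⟨h, hx.2⟩, ?_⟩
      rw [Filter.EventuallyEq, QuotientAddGroup.nhds_eq, Filter.eventually_map]
      filter_upwards [Ioo_mem_nhds h hx.2] with y hy
      rw [hgφ ⟨(hac.trans hcb).trans hy.1.le, hy.2⟩, hφ_gt hy.1]
  · intro t
    obtain ⟨x, hx, rfl⟩ := hrep t
    rw [hgφ hx]
    rcases le_or_gt x b with hxb | hxb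
    · refine .inr ⟨hφS hx.1 hxb, c, hcS, (dist_coe_circle_le c x).trans_lt ?_⟩
      rw [abs_lt]
      constructor <;> linarith [hx.1]
    · exact .inl (hφ_gt hxb)

/-- Straightening a Jordan curve inside each member of a finite disjoint family of convex sets. -/
lemma exists_straightening_of_pairwiseDisjoint {h : C(AddCircle (1 : ℝ), V)}
    (hh : Function.Injective h) {η : ℝ} (hη : η ≤ 1 / 4) {C : Set (Set V)} (hC : C.Finite)
    (hdisj : C.PairwiseDisjoint id) (hclosed : ∀ S ∈ C, IsClosed S) (hconv : ∀ S ∈ C, Convex ℝ S)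
    (hS : ∀ S ∈ C, ∀ s t, h s ∈ S → h t ∈ S → dist s t < η) :
    ∃ g : C(AddCircle (1 : ℝ), V), Function.Injective g ∧
      (∃ F : Set (AddCircle (1 : ℝ)), F.Finite ∧
        ∀ t ∉ F, CircleAffineAt g t ∨ ((∀ S ∈ C, h t ∉ S) ∧ g =ᶠ[𝓝 t] h)) ∧
      ∀ t, g t = h t ∨ ∃ S ∈ C, g t ∈ S ∧ ∃ s, h s ∈ S ∧ dist s t < η := by
  induction C, hC using Set.Finite.induction_on with
  | empty =>
    exact ⟨h, hh, ⟨∅, Set.finite_empty, fun t _ => .inr ⟨by simp, .rfl⟩⟩, fun t => .inl rfl⟩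
  | @insert T C hT hC ih =>
    obtain ⟨f, hf, ⟨F, hF, hFf⟩, hfh⟩ := ih (hdisj.subset (Set.subset_insert _ _))
      (fun S hSC => hclosed S (.inr hSC)) (fun S hSC => hconv S (.inr hSC))
      (fun S hSC => hS S (.inr hSC))
    have hfT : ∀ t, f t ∈ T → f t = h t := by
      intro t ht
      refine (hfh t).resolve_right ?_
      rintro ⟨S, hSC, hft, -⟩
      have hne : S ≠ T := by
        rintro rfl
        exact hT hSC
      exact Set.disjoint_left.1 (hdisj (.inr hSC) (Set.mem_insert T C) hne) hft ht
    obtain ⟨g, hg, ⟨G, hG, hGg⟩, hgf⟩ := exists_straightening hf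
      (hclosed T (Set.mem_insert T C)) (hconv T (Set.mem_insert T C)) hη
      (fun s t hs ht => hS T (Set.mem_insert T C) s t (hfT s hs ▸ hs) (hfT t ht ▸ ht))
    refine ⟨g, hg, ⟨F ∪ G, hF.union hG, ?_⟩, ?_⟩
    · intro t ht
      rw [Set.mem_union, not_or] at ht
      rcases hGg t ht.2 with hlin | ⟨hnot, hgf⟩
      · exact .inl hlin
      rcases hFf t ht.1 with hlin | ⟨hnot', hfh⟩
      · exact .inl (hlin.congr hgf)
      refine .inr ⟨?_, hgf.trans hfh⟩
      rintro S (rfl | hSC)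
      · rwa [← hfh.eq_of_nhds]
      · exact hnot' S hSC
    · intro t
      rcases hgf t with h₁ | ⟨h₁, s, h₂, h₃⟩
      · rw [h₁]
        refine (hfh t).imp_right ?_
        rintro ⟨S, hSC, h₂⟩
        exact ⟨S, .inr hSC, h₂⟩
      · exact .inr ⟨T, Set.mem_insert T C, h₁, s, hfT s h₂ ▸ h₂, h₃⟩

/-- Straightening a Jordan curve successively along `m` disjoint families of small convex sets. The
required smallness of the sets depends only on `m`. -/
lemma exists_approx_affine_on_families {ψ : C(AddCircle (1 : ℝ), V)} (hψ : Function.Injective ψ)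
    (m : ℕ) (ε : ℝ) (hε : 0 < ε) :
    ∃ d > 0, ∀ L : List (Set (Set V)), L.length = m →
      (∀ C ∈ L, C.Finite ∧ C.PairwiseDisjoint id ∧
        ∀ S ∈ C, IsClosed S ∧ Convex ℝ S ∧ ∀ x ∈ S, ∀ y ∈ S, dist x y ≤ d) →
      ∃ g : C(AddCircle (1 : ℝ), V), Function.Injective g ∧ (∀ t, dist (g t) (ψ t) < ε) ∧
        ∃ F : Set (AddCircle (1 : ℝ)), F.Finite ∧
          ∀ t ∉ F, CircleAffineAt g t ∨ (g t = ψ t ∧ ∀ C ∈ L, ∀ S ∈ C, ψ t ∉ S) := by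
  induction m generalizing ε with
  | zero =>
    refine ⟨1, one_pos, fun L hL _ => ⟨ψ, hψ, by simpa using hε, ∅, Set.finite_empty, ?_⟩⟩
    obtain rfl := List.length_eq_zero_iff.1 hL
    simp
  | succ m ih =>
    obtain ⟨η, hη, hψη⟩ := Metric.uniformContinuous_iff.1
      (CompactSpace.uniformContinuous_of_continuous ψ.continuous) (ε / 3) (by linarith)
    obtain ⟨ρ, hρ, hψρ⟩ := exists_dist_lt_of_dist_image_lt hψ
      (η := min η (1 / 4)) (lt_min hη (by norm_num))
    obtain ⟨d, hd, ih⟩ := ih (min (ε / 3) (ρ / 3)) (lt_min (by linarith) (by linarith))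
    refine ⟨min d (min (ε / 3) (ρ / 3)),
      lt_min hd (lt_min (by linarith) (by linarith)), fun L hL hLC => ?_⟩
    obtain ⟨C, L, rfl⟩ := List.exists_cons_of_length_eq_add_one hL
    have hdiam : ∀ {S}, S ∈ C → ∀ x ∈ S, ∀ y ∈ S, dist x y ≤ min (ε / 3) (ρ / 3) :=
      fun {S} hSC x hx y hy =>
        (((hLC C List.mem_cons_self).2.2 S hSC).2.2 x hx y hy).trans (min_le_right _ _)
    obtain ⟨h, hh, hhψ, F, hF, hFh⟩ := ih L (by simpa using hL) fun C' hC' => by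
      obtain ⟨h₁, h₂, h₃⟩ := hLC C' (List.mem_cons_of_mem C hC')
      exact ⟨h₁, h₂, fun S hSC => ⟨(h₃ S hSC).1, (h₃ S hSC).2.1,
        fun x hx y hy => ((h₃ S hSC).2.2 x hx y hy).trans (min_le_left _ _)⟩⟩
    obtain ⟨hCfin, hCdisj, hC⟩ := hLC C List.mem_cons_self
    obtain ⟨g, hg, ⟨G, hG, hGg⟩, hgh⟩ := exists_straightening_of_pairwiseDisjoint hh
      (min_le_right η (1 / 4)) hCfin hCdisj (fun S hSC => (hC S hSC).1)
      (fun S hSC => (hC S hSC).2.1) (fun S hSC s t hs ht => hψρ s t (by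
        have h₁ := (hhψ s).trans_le (min_le_right _ _)
        have h₂ := (hhψ t).trans_le (min_le_right _ _)
        have h₃ := (hdiam hSC _ hs _ ht).trans (min_le_right _ _)
        have h₄ := dist_triangle4_left (h s) (h t) (ψ s) (ψ t)
        linarith))
    refine ⟨g, hg, fun t => ?_, F ∪ G, hF.union hG, fun t ht => ?_⟩
    · have h₀ := (hhψ t).trans_le (min_le_left _ _)
      rcases hgh t with h₁ | ⟨S, hSC, h₁, s, h₂, h₃⟩
      · rw [h₁]
        linarith
      · have h₄ := (hdiam hSC _ h₁ _ h₂).trans (min_le_left _ _)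
        have h₅ := (hhψ s).trans_le (min_le_left _ _)
        have h₆ := hψη (h₃.trans_le (min_le_left _ _))
        have h₇ := dist_triangle4 (g t) (h s) (ψ s) (ψ t)
        linarith
    · rw [Set.mem_union, not_or] at ht
      rcases hGg t ht.2 with hlin | ⟨hnot, hgh⟩
      · exact .inl hlin
      rcases hFh t ht.1 with hlin | ⟨hht, hnot'⟩
      · exact .inl (hlin.congr hgh)
      refine .inr ⟨hgh.eq_of_nhds.trans hht, fun C' hC' => ?_⟩
      rcases List.mem_cons.1 hC' with rfl | hC'
      · rwa [← hht]
      · exact hnot' C' hC'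

end Circle

section Affine

variable {V : Type*} [NormedAddCommGroup V] [NormedSpace ℝ V]

lemma exists_affine_on_Icc {f : ℝ → V} (hf : Continuous f) {a b : ℝ} (hab : a < b)
    (h : ∀ x ∈ Set.Ioo a b, LocallyAffineAt f x) :
    ∃ u v : V, ∀ x ∈ Set.Icc a b, f x = u + x • v := by
  have hderiv : ∀ x ∈ Set.Ioo a b, ∃ v : V, (∀ᶠ y in 𝓝 x, HasDerivAt f v y) := by
    intro x hx
    obtain ⟨u, v, huv⟩ := h x hx
    refine ⟨v, ?_⟩
    filter_upwards [huv.eventually_nhds] with y hy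
    have h₁ : HasDerivAt (fun z : ℝ => u + z • v) v y := by
      simpa using ((hasDerivAt_id y).smul_const v).const_add u
    exact h₁.congr_of_eventuallyEq hy
  have hdd : ∀ x ∈ Set.Ioo a b, HasDerivAt (deriv f) 0 x := by
    intro x hx
    obtain ⟨v, hv⟩ := hderiv x hx
    exact (hasDerivAt_const x v).congr_of_eventuallyEq (hv.mono fun y hy => hy.deriv)
  obtain ⟨v, hv⟩ := isOpen_Ioo.exists_is_const_of_deriv_eq_zero isPreconnected_Ioo
    (fun x hx => (hdd x hx).differentiableAt.differentiableWithinAt) (fun x hx => (hdd x hx).deriv)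
  have hsub : ∀ x ∈ Set.Ioo a b, HasDerivAt (fun y => f y - y • v) 0 x := by
    intro x hx
    obtain ⟨w, hw⟩ := hderiv x hx
    have h₁ := hw.self_of_nhds
    rw [← h₁.deriv.symm.trans (hv x hx)] at *
    exact (h₁.sub ((hasDerivAt_id x).smul_const w)).congr_deriv (by simp)
  obtain ⟨u, hu⟩ := isOpen_Ioo.exists_is_const_of_deriv_eq_zero isPreconnected_Ioo
    (fun x hx => (hsub x hx).differentiableAt.differentiableWithinAt)
    (fun x hx => (hsub x hx).deriv)
  refine ⟨u, v, ?_⟩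
  have hcl : IsClosed {x : ℝ | f x = u + x • v} := isClosed_eq hf (by fun_prop)
  have hsubset : Set.Ioo a b ⊆ {x : ℝ | f x = u + x • v} := by
    intro x hx
    change f x = u + x • v
    rw [← hu x hx]
    abel
  rw [← closure_Ioo hab.ne]
  exact hcl.closure_subset_iff.2 hsubset

end Affine

lemma exists_subdivision (B : Set ℝ) (hB : B.Finite) (h0 : 0 ∈ B) (h1 : 1 ∈ B)
    (hB01 : B ⊆ Set.Icc 0 1) :
    ∃ (k : ℕ) (s : ℕ → ℝ), 0 < k ∧ s 0 = 0 ∧ s k = 1 ∧ (∀ j < k, s j < s (j + 1)) ∧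
      (∀ j ≤ k, s j ∈ Set.Icc (0 : ℝ) 1) ∧ ∀ j < k, ∀ x ∈ Set.Ioo (s j) (s (j + 1)), x ∉ B := by
  lift B to Finset ℝ using hB
  have hcard : 1 < B.card := Finset.one_lt_card.2 ⟨0, h0, 1, h1, zero_ne_one⟩
  set e := B.orderEmbOfFin rfl
  have he : ∀ i, e i ∈ B := B.orderEmbOfFin_mem rfl
  have hsurj : ∀ x ∈ B, ∃ i, e i = x := by
    intro x hx
    have : x ∈ Set.range e := by
      rw [B.range_orderEmbOfFin rfl]
      exact hx
    exact this
  set s : ℕ → ℝ := fun j => if hj : j < B.card then e ⟨j, hj⟩ else 0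
  have hs : ∀ {j} (hj : j < B.card), s j = e ⟨j, hj⟩ := fun hj => dif_pos hj
  refine ⟨B.card - 1, s, by omega, ?_, ?_, ?_, ?_, ?_⟩
  · obtain ⟨i, hi⟩ := hsurj 0 h0
    rw [hs (by omega)]
    refine le_antisymm ?_ (hB01 (he _)).1
    rw [← hi]
    exact e.monotone (Nat.zero_le _)
  · obtain ⟨i, hi⟩ := hsurj 1 h1
    rw [hs (by omega)]
    refine le_antisymm (hB01 (he _)).2 ?_
    rw [← hi]
    exact e.monotone (Nat.le_sub_one_of_lt i.2)
  · intro j hj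
    rw [hs (by omega), hs (by omega)]
    exact e.strictMono (Nat.lt_succ_self j)
  · intro j hj
    rw [hs (by omega)]
    exact hB01 (he _)
  · rintro j hj x ⟨h₁, h₂⟩ hx
    obtain ⟨i, rfl⟩ := hsurj x hx
    rw [hs (by omega), e.lt_iff_lt, Fin.lt_def] at h₁
    rw [hs (by omega), e.lt_iff_lt, Fin.lt_def] at h₂
    simp only at h₁ h₂
    omega

lemma isPolygonalClosedCurve_of_circleAffineAt
    (g : C(AddCircle (1 : ℝ), EuclideanSpace ℝ (Fin 2))) {F : Set (AddCircle (1 : ℝ))}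
    (hF : F.Finite) (hg : ∀ t ∉ F, CircleAffineAt g t) : IsPolygonalClosedCurve g := by
  have hfin : {x ∈ Set.Ico (0 : ℝ) 1 | (x : AddCircle (1 : ℝ)) ∈ F}.Finite := by
    refine Set.Finite.of_finite_image (f := fun x : ℝ => (x : AddCircle (1 : ℝ)))
      (hF.subset ?_) ?_
    · rintro _ ⟨x, hx, rfl⟩
      exact hx.2
    · intro x hx y hy hxy
      have hx₁ : x ∈ Set.Ico (0 : ℝ) (0 + 1) := by simpa using hx.1
      have hy₁ : y ∈ Set.Ico (0 : ℝ) (0 + 1) := by simpa using hy.1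
      exact (AddCircle.coe_eq_coe_iff_of_mem_Ico hx₁ hy₁).1 hxy
  obtain ⟨k, s, hk, hs0, hsk, hlt, hs01, hs⟩ := exists_subdivision
    ({0, 1} ∪ {x ∈ Set.Ico (0 : ℝ) 1 | (x : AddCircle (1 : ℝ)) ∈ F})
    ((by simp : ({0, 1} : Set ℝ).Finite).union hfin) (by simp) (by simp) (by
      rintro x ((rfl | rfl) | hx)
      · simp
      · simp
      · exact ⟨hx.1.1, hx.1.2.le⟩)
  refine ⟨k, s, fun j => g (s j), hk, hs0, hsk, hlt, ?_, fun j hj x hx => ?_⟩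
  · simp [hs0, hsk, AddCircle.coe_period]
  obtain ⟨u, v, huv⟩ := exists_affine_on_Icc (f := fun x : ℝ => g x)
    (g.continuous.comp QuotientAddGroup.continuous_mk) (hlt j hj) (fun y hy => by
      refine hg y (fun hyF => hs j hj y hy (.inr ⟨⟨?_, ?_⟩, hyF⟩)) y rfl
      · exact (hs01 j hj.le).1.trans hy.1.le
      · exact hy.2.trans_le (hs01 (j + 1) hj).2)
  simp only at huv ⊢
  rw [huv x hx, huv _ ⟨le_rfl, (hlt j hj).le⟩, huv _ ⟨(hlt j hj).le, le_rfl⟩]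
  have hne : s (j + 1) - s j ≠ 0 := sub_ne_zero.2 (hlt j hj).ne'
  have h₁ : u + s (j + 1) • v - (u + s j • v) = (s (j + 1) - s j) • v := by module
  rw [h₁, smul_smul, div_mul_cancel₀ _ hne]
  module

section Grid

/-- The closed grid square of side `r` with lower left corner `(i r, j r)`. -/
def gridSquare (r : ℝ) (i j : ℤ) : Set (EuclideanSpace ℝ (Fin 2)) :=
  {x | x 0 ∈ Set.Icc (i * r) ((i + 1) * r) ∧ x 1 ∈ Set.Icc (j * r) ((j + 1) * r)}

lemma isClosed_gridSquare (r : ℝ) (i j : ℤ) : IsClosed (gridSquare r i j) :=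
  (isClosed_Icc.preimage (by fun_prop)).inter (isClosed_Icc.preimage (by fun_prop))

lemma convex_gridSquare (r : ℝ) (i j : ℤ) : Convex ℝ (gridSquare r i j) :=
  ((convex_Icc _ _).linear_preimage (EuclideanSpace.proj (𝕜 := ℝ) (0 : Fin 2)).toLinearMap).inter
    ((convex_Icc _ _).linear_preimage (EuclideanSpace.proj (𝕜 := ℝ) (1 : Fin 2)).toLinearMap)

lemma dist_le_of_mem_gridSquare {r : ℝ} (hr : 0 ≤ r) {i j : ℤ} {x y : EuclideanSpace ℝ (Fin 2)}
    (hx : x ∈ gridSquare r i j) (hy : y ∈ gridSquare r i j) : dist x y ≤ 2 * r := by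
  obtain ⟨⟨h₁, h₂⟩, h₃, h₄⟩ := hx
  obtain ⟨⟨h₅, h₆⟩, h₇, h₈⟩ := hy
  rw [EuclideanSpace.dist_eq, Fin.sum_univ_two, Real.dist_eq, Real.dist_eq, sq_abs, sq_abs]
  refine Real.sqrt_le_iff.2 ⟨by linarith, ?_⟩
  have h₉ : (x 0 - y 0) ^ 2 ≤ r ^ 2 := sq_le_sq' (by linarith) (by linarith)
  have h₀ : (x 1 - y 1) ^ 2 ≤ r ^ 2 := sq_le_sq' (by linarith) (by linarith)
  nlinarith

lemma eq_of_mem_Icc_two_mul_add {r : ℝ} (hr : 0 < r) {p i i' : ℤ} {x : ℝ}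
    (h : x ∈ Set.Icc (((2 * i + p : ℤ) : ℝ) * r) ((((2 * i + p : ℤ) : ℝ) + 1) * r))
    (h' : x ∈ Set.Icc (((2 * i' + p : ℤ) : ℝ) * r) ((((2 * i' + p : ℤ) : ℝ) + 1) * r)) :
    i = i' := by
  have h₁ := le_of_mul_le_mul_right (h.1.trans h'.2) hr
  have h₂ := le_of_mul_le_mul_right (h'.1.trans h.2) hr
  norm_cast at h₁ h₂
  omega

/-- Grid squares in a bounded part of the plane whose indices have prescribed parities. -/
def gridFamily (r : ℝ) (N p q : ℤ) : Set (Set (EuclideanSpace ℝ (Fin 2))) :=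
  (fun ij : ℤ × ℤ => gridSquare r (2 * ij.1 + p) (2 * ij.2 + q)) ''
    (Set.Icc (-N) N ×ˢ Set.Icc (-N) N)

lemma finite_gridFamily (r : ℝ) (N p q : ℤ) : (gridFamily r N p q).Finite :=
  ((Set.finite_Icc _ _).prod (Set.finite_Icc _ _)).image _

lemma pairwiseDisjoint_gridFamily {r : ℝ} (hr : 0 < r) (N p q : ℤ) :
    (gridFamily r N p q).PairwiseDisjoint id := by
  rintro _ ⟨⟨i, j⟩, -, rfl⟩ _ ⟨⟨i', j'⟩, -, rfl⟩ hne
  refine Set.disjoint_left.2 fun x hx hx' => hne ?_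
  obtain rfl := eq_of_mem_Icc_two_mul_add hr hx.1 hx'.1
  obtain rfl := eq_of_mem_Icc_two_mul_add hr hx.2 hx'.2
  rfl

lemma exists_parity_index {r R x : ℝ} (hr : 0 < r) (hx : |x| ≤ R) :
    ∃ p ∈ ({0, 1} : Set ℤ), ∃ i ∈ Set.Icc (-(⌈R / r⌉ + 1)) (⌈R / r⌉ + 1),
      x ∈ Set.Icc (((2 * i + p : ℤ) : ℝ) * r) ((((2 * i + p : ℤ) : ℝ) + 1) * r) := by
  have hfl := Int.floor_le (x / r)
  have hfl' := (Int.lt_floor_add_one (x / r)).le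
  have hxR := abs_le.1 hx
  have hceil := Int.le_ceil (R / r)
  have h₁ : -(R / r) ≤ x / r := by
    rw [← neg_div]
    exact div_le_div_of_nonneg_right hxR.1 hr.le
  have h₂ : x / r ≤ R / r := div_le_div_of_nonneg_right hxR.2 hr.le
  have h₃ : ⌊x / r⌋ ≤ ⌈R / r⌉ := by exact_mod_cast hfl.trans (h₂.trans hceil)
  have h₄ : -⌈R / r⌉ ≤ ⌊x / r⌋ + 1 := by
    have : -(⌈R / r⌉ : ℝ) ≤ ⌊x / r⌋ + 1 := by linarith
    exact_mod_cast this
  refine ⟨⌊x / r⌋ % 2, ?_, ⌊x / r⌋ / 2, ⟨by omega, by omega⟩, ?_⟩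
  · rcases Int.emod_two_eq_zero_or_one ⌊x / r⌋ with h | h <;> simp [h]
  · rw [Int.mul_ediv_add_emod]
    exact ⟨(le_div_iff₀ hr).1 hfl, (div_le_iff₀ hr).1 hfl'⟩

lemma exists_mem_gridFamily {r R : ℝ} (hr : 0 < r) {x : EuclideanSpace ℝ (Fin 2)}
    (hx : ‖x‖ ≤ R) : ∃ p ∈ ({0, 1} : Set ℤ), ∃ q ∈ ({0, 1} : Set ℤ),
      ∃ S ∈ gridFamily r (⌈R / r⌉ + 1) p q, x ∈ S := by
  obtain ⟨p, hp, i, hi, hxi⟩ := exists_parity_index hr ((PiLp.norm_apply_le x 0).trans hx)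
  obtain ⟨q, hq, j, hj, hxj⟩ := exists_parity_index hr ((PiLp.norm_apply_le x 1).trans hx)
  exact ⟨p, hp, q, hq, _, ⟨(i, j), ⟨hi, hj⟩, rfl⟩, hxi, hxj⟩

end Grid

/-- Polygonal approximation of Jordan curves: every Jordan curve `ψ : S¹ → ℝ²` can be
uniformly `δ`-approximated by a polygonal Jordan curve. -/
theorem jordan_curve_polygonal_approximation
    (ψ : C(AddCircle (1 : ℝ), EuclideanSpace ℝ (Fin 2))) (hψ : Function.Injective ψ)
    (δ : ℝ) (hδ : 0 < δ) :
    ∃ ψ' : C(AddCircle (1 : ℝ), EuclideanSpace ℝ (Fin 2)),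
      Function.Injective ψ' ∧ IsPolygonalClosedCurve ψ' ∧
      ∀ t : AddCircle (1 : ℝ), ‖ψ t - ψ' t‖ < δ := by
  obtain ⟨d, hd, H⟩ := exists_approx_affine_on_families hψ 4 δ hδ
  have hr : 0 < d / 2 := half_pos hd
  set N : ℤ := ⌈‖ψ‖ / (d / 2)⌉ + 1
  obtain ⟨g, hg, hgψ, F, hF, hFg⟩ := H
    [gridFamily (d / 2) N 0 0, gridFamily (d / 2) N 0 1, gridFamily (d / 2) N 1 0,
      gridFamily (d / 2) N 1 1] rfl (by
    intro C hC
    obtain ⟨p, q, rfl⟩ : ∃ p q, C = gridFamily (d / 2) N p q := by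
      simp only [List.mem_cons, List.not_mem_nil, or_false] at hC
      rcases hC with h | h | h | h <;> exact ⟨_, _, h⟩
    refine ⟨finite_gridFamily _ _ _ _, pairwiseDisjoint_gridFamily hr _ _ _, ?_⟩
    rintro _ ⟨⟨i, j⟩, -, rfl⟩
    refine ⟨isClosed_gridSquare _ _ _, convex_gridSquare _ _ _, fun x hx y hy => ?_⟩
    have := dist_le_of_mem_gridSquare hr.le hx hy
    linarith)
  refine ⟨g, hg, isPolygonalClosedCurve_of_circleAffineAt g hF fun t ht => ?_, fun t => ?_⟩
  · refine (hFg t ht).resolve_right ?_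
    rintro ⟨-, hnot⟩
    obtain ⟨p, hp, q, hq, S, hS, htS⟩ := exists_mem_gridFamily hr (ψ.norm_coe_le_norm t)
    refine hnot (gridFamily (d / 2) N p q) ?_ S hS htS
    rcases hp with rfl | rfl <;> rcases hq with rfl | rfl <;> simp
  · rw [← dist_eq_norm, dist_comm]
    exact hgψ t
end

section
/- Let 𝔛 be a Z-valued switched Bebutov shift, let (ψₙ)_{n≥1} be a sequence in 𝔛, and let (τₙ)_{n≥0} be a strictly increasing unbounded sequence of real numbers with τ₀ = 0 such that ψₙ(τₙ) = ψ_{n+1}(τₙ) for every n ≥ 1. Then the function ξ : [0,∞) → Z which coincides with ψₙ on the interval [τ_{n−1}, τₙ] for each n ≥ 1 is well defined, continuous, and belongs to 𝔛. -/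
open scoped NNReal
open Filter Topology

/-- The shift semiflow `σ^τ` on `C([0,∞), Z)`. -/
noncomputable def bebShift {Z : Type*} [TopologicalSpace Z] (τ : ℝ≥0) (φ : C(ℝ≥0, Z)) :
    C(ℝ≥0, Z) :=
  φ.comp ⟨fun t => t + τ, continuous_id.add continuous_const⟩

/-- A `Z`-valued switched Bebutov shift: a compact, shift-invariant subset of `C([0,∞), Z)`
(with the compact-open topology) satisfying the switching axiom. -/
def IsSwitchedBebutovShift {Z : Type*} [TopologicalSpace Z] (X : Set C(ℝ≥0, Z)) : Prop :=
  IsCompact X ∧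
  (∀ φ ∈ X, ∀ τ : ℝ≥0, bebShift τ φ ∈ X) ∧
  (∀ φ₁ ∈ X, ∀ φ₂ ∈ X, ∀ τ : ℝ≥0, 0 < τ → φ₁ τ = φ₂ τ →
    ∀ ψ : C(ℝ≥0, Z), (∀ t, t ≤ τ → ψ t = φ₁ t) → (∀ t, τ ≤ t → ψ t = φ₂ t) → ψ ∈ X)

/-- The concatenation at time `τ` of two maps agreeing at `τ`; it is `φ₁` if they do not agree. -/
noncomputable def switchAt {Z : Type*} [TopologicalSpace Z] (τ : ℝ≥0) (φ₁ φ₂ : C(ℝ≥0, Z)) :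
    C(ℝ≥0, Z) :=
  open Classical in
  if h : φ₁ τ = φ₂ τ then
    ⟨fun t => if t ≤ τ then φ₁ t else φ₂ t,
      φ₁.continuous.if_le φ₂.continuous continuous_id continuous_const
        (fun t ht => by rw [show t = τ from ht, h])⟩
  else φ₁

lemma switchAt_of_le {Z : Type*} [TopologicalSpace Z] {τ t : ℝ≥0} (φ₁ φ₂ : C(ℝ≥0, Z))
    (ht : t ≤ τ) : switchAt τ φ₁ φ₂ t = φ₁ t := by
  unfold switchAt
  split_ifs <;> simp [ht]

lemma switchAt_of_ge {Z : Type*} [TopologicalSpace Z] {τ t : ℝ≥0} {φ₁ φ₂ : C(ℝ≥0, Z)}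
    (h : φ₁ τ = φ₂ τ) (ht : τ ≤ t) : switchAt τ φ₁ φ₂ t = φ₂ t := by
  rcases ht.eq_or_lt with rfl | ht
  · rw [switchAt_of_le _ _ le_rfl, h]
  · simp [switchAt, h, ht.not_ge]

lemma IsSwitchedBebutovShift.switchAt_mem {Z : Type*} [TopologicalSpace Z] {X : Set C(ℝ≥0, Z)}
    (hX : IsSwitchedBebutovShift X) {τ : ℝ≥0} (hτ : 0 < τ) {φ₁ φ₂ : C(ℝ≥0, Z)}
    (h₁ : φ₁ ∈ X) (h₂ : φ₂ ∈ X) (h : φ₁ τ = φ₂ τ) : switchAt τ φ₁ φ₂ ∈ X :=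
  hX.2.2 φ₁ h₁ φ₂ h₂ τ hτ h _ (fun _ ht => switchAt_of_le _ _ ht)
    (fun _ ht => switchAt_of_ge h ht)

/-- The concatenation of `ψ 1, …, ψ (n + 1)` at the times `τ 1, …, τ n`. -/
noncomputable def finiteConcat {Z : Type*} [TopologicalSpace Z] (ψ : ℕ → C(ℝ≥0, Z))
    (τ : ℕ → ℝ≥0) : ℕ → C(ℝ≥0, Z)
  | 0 => ψ 1
  | n + 1 => switchAt (τ (n + 1)) (finiteConcat ψ τ n) (ψ (n + 2))

section finiteConcat

variable {Z : Type*} [TopologicalSpace Z] {ψ : ℕ → C(ℝ≥0, Z)} {τ : ℕ → ℝ≥0}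

lemma finiteConcat_of_ge (hmono : Monotone τ)
    (hmatch : ∀ n : ℕ, 1 ≤ n → ψ n (τ n) = ψ (n + 1) (τ n)) (n : ℕ) {t : ℝ≥0} (ht : τ n ≤ t) :
    finiteConcat ψ τ n t = ψ (n + 1) t := by
  induction n generalizing t with
  | zero => rfl
  | succ n ih =>
    exact switchAt_of_ge ((ih (hmono n.le_succ)).trans (hmatch (n + 1) (by omega))) ht

lemma finiteConcat_eq_of_le (hmono : Monotone τ) {n m : ℕ} (hnm : n ≤ m) {t : ℝ≥0}
    (ht : t ≤ τ (n + 1)) : finiteConcat ψ τ m t = finiteConcat ψ τ n t := by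
  induction m, hnm using Nat.le_induction with
  | base => rfl
  | succ m hm ih =>
    exact (switchAt_of_le _ _ (ht.trans (hmono (by omega)))).trans ih

lemma IsSwitchedBebutovShift.finiteConcat_mem {X : Set C(ℝ≥0, Z)}
    (hX : IsSwitchedBebutovShift X) (hψ : ∀ n : ℕ, 1 ≤ n → ψ n ∈ X) (hmono : StrictMono τ)
    (hmatch : ∀ n : ℕ, 1 ≤ n → ψ n (τ n) = ψ (n + 1) (τ n)) (n : ℕ) :
    finiteConcat ψ τ n ∈ X := by
  induction n with
  | zero => exact hψ 1 le_rfl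
  | succ n ih =>
    refine hX.switchAt_mem ((zero_le).trans_lt (hmono n.lt_succ_self)) ih (hψ _ (by omega)) ?_
    exact (finiteConcat_of_ge hmono.monotone hmatch n (hmono.monotone n.le_succ)).trans
      (hmatch (n + 1) (by omega))

end finiteConcat

/-- Multiple switching lemma: an infinite concatenation of elements of a switched Bebutov
shift along a strictly increasing unbounded sequence of matching times belongs to the shift.
(The existence of the continuous map `ξ` expresses that the concatenation is well defined
and continuous.) -/
theorem multiple_switching
    {Z : Type*} [TopologicalSpace Z] [CompactSpace Z] [TopologicalSpace.MetrizableSpace Z]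
    (X : Set C(ℝ≥0, Z)) (hX : IsSwitchedBebutovShift X)
    (ψ : ℕ → C(ℝ≥0, Z)) (hψ : ∀ n : ℕ, 1 ≤ n → ψ n ∈ X)
    (τ : ℕ → ℝ≥0) (hτ0 : τ 0 = 0) (hmono : StrictMono τ)
    (hunb : Tendsto τ atTop atTop)
    (hmatch : ∀ n : ℕ, 1 ≤ n → ψ n (τ n) = ψ (n + 1) (τ n)) :
    ∃ ξ : C(ℝ≥0, Z),
      (∀ n : ℕ, 1 ≤ n → ∀ t : ℝ≥0, τ (n - 1) ≤ t → t ≤ τ n → ξ t = ψ n t) ∧ ξ ∈ X := by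
  obtain ⟨ξ, hξX, hξ⟩ := hX.1 (f := map (finiteConcat ψ τ) atTop)
    (tendsto_principal.2 (Eventually.of_forall (hX.finiteConcat_mem hψ hmono hmatch)))
  refine ⟨ξ, fun n hn t h₁ h₂ => ?_, hξX⟩
  obtain ⟨k, rfl⟩ : ∃ k, n = k + 1 := ⟨n - 1, by omega⟩
  have hlim : Tendsto (fun m => finiteConcat ψ τ m t) atTop (𝓝 (ψ (k + 1) t)) := by
    refine tendsto_const_nhds.congr' ?_
    filter_upwards [eventually_ge_atTop k] with m hm
    rw [finiteConcat_eq_of_le hmono.monotone hm h₂,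
      finiteConcat_of_ge hmono.monotone hmatch k h₁]
  have hcl : MapClusterPt (ξ t) atTop (fun m => finiteConcat ψ τ m t) :=
    MapClusterPt.continuousAt_comp (continuous_eval_const t).continuousAt hξ
  exact eq_of_nhds_neBot (ClusterPt.mono hcl hlim)
end

section
/- Let 𝔛 be a Z-valued switched Bebutov shift and let φ ∈ 𝔛 be recurrent with respect to the shift semiflow (σ^t)_{t≥0}. Then for every s ≥ 0 there exists ψ ∈ 𝔛 such that σ^s ψ = φ, i.e. ψ(s+t) = φ(t) for all t ≥ 0. -/
open scoped NNReal
open Filter Topology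

/-- `φ` is recurrent with respect to the shift semiflow: there is a sequence `tₙ → ∞`
with `σ^{tₙ}φ → φ` in the compact-open topology. -/
def IsShiftRecurrent {Z : Type*} [TopologicalSpace Z] (φ : C(ℝ≥0, Z)) : Prop :=
  ∃ t : ℕ → ℝ≥0, Tendsto t atTop atTop ∧ Tendsto (fun n => bebShift (t n) φ) atTop (𝓝 φ)

theorem continuous_bebShift {Z : Type*} [TopologicalSpace Z] (τ : ℝ≥0) :
    Continuous (bebShift τ : C(ℝ≥0, Z) → C(ℝ≥0, Z)) :=
  ContinuousMap.continuous_precomp _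

theorem bebShift_bebShift {Z : Type*} [TopologicalSpace Z] (σ τ : ℝ≥0) (φ : C(ℝ≥0, Z)) :
    bebShift σ (bebShift τ φ) = bebShift (τ + σ) φ := by
  ext t
  simp [bebShift, add_assoc, add_comm σ τ]

/-- In a compact shift-invariant set, any cluster point of `σ^{tₙ - s}φ` is mapped by `σ^s`
to the limit of `σ^{tₙ}φ`. -/
theorem exists_bebShift_eq_of_tendsto {Z : Type*} [TopologicalSpace Z] [T2Space Z]
    {X : Set C(ℝ≥0, Z)} (hX : IsCompact X) (hshift : ∀ φ ∈ X, ∀ τ : ℝ≥0, bebShift τ φ ∈ X)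
    {φ χ : C(ℝ≥0, Z)} (hφ : φ ∈ X) {t : ℕ → ℝ≥0} (ht : Tendsto t atTop atTop)
    (hlim : Tendsto (fun n => bebShift (t n) φ) atTop (𝓝 χ)) (s : ℝ≥0) :
    ∃ ψ ∈ X, bebShift s ψ = χ := by
  let U : Ultrafilter ℕ := Ultrafilter.of atTop
  have hU : (U : Filter ℕ) ≤ atTop := Ultrafilter.of_le atTop
  obtain ⟨ψ, hψ, hle⟩ := hX.ultrafilter_le_nhds (U.map fun n => bebShift (t n - s) φ) <|
    tendsto_principal.2 <| Eventually.of_forall fun n => hshift φ hφ (t n - s)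
  have htend : Tendsto (fun n => bebShift (t n - s) φ) U (𝓝 ψ) := hle
  refine ⟨ψ, hψ, tendsto_nhds_unique (((continuous_bebShift s).tendsto ψ).comp htend) ?_⟩
  refine (hlim.mono_left hU).congr' ?_
  filter_upwards [hU (ht.eventually_ge_atTop s)] with n hn
  rw [Function.comp_apply, bebShift_bebShift, tsub_add_cancel_of_le hn]

/-- A recurrent element of a switched Bebutov shift can be translated backwards in time:
for every `s ≥ 0` there exists `ψ` in the shift with `σ^s ψ = φ`. -/
theorem recurrent_has_inverse_branches
    {Z : Type*} [TopologicalSpace Z] [CompactSpace Z] [TopologicalSpace.MetrizableSpace Z]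
    (X : Set C(ℝ≥0, Z)) (hX : IsSwitchedBebutovShift X)
    (φ : C(ℝ≥0, Z)) (hφ : φ ∈ X) (hrec : IsShiftRecurrent φ) (s : ℝ≥0) :
    ∃ ψ ∈ X, bebShift s ψ = φ := by
  obtain ⟨t, ht, hlim⟩ := hrec
  exact exists_bebShift_eq_of_tendsto hX.1 hX.2.1 hφ ht hlim s
end
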